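/- In the nested exponential family setting with Bayes marginals p_{B,0}, p_{B,1} built from continuous strictly positive prior densities, let M₁' be a CINECSI subset of M₁. Then there exist positive constants c₁, c₂, c₃ and b₁, b₂, b₃ such that for all n, all μ₁ ∈ M₁', and all A ∈ ℝ: P_{μ₁}(log(p_{B,1}(Xⁿ)/p_{B,0}(Xⁿ)) < A) ≤ n^{m₁/2}·c₁·e^{c₂A/2}·e^{−(n/2)c₃‖μ₁−μ₀‖₂²} + small_b(n), where μ₀ = Π₀(μ₁) is the projection of μ₁ onto M₀ and Xⁿ is i.i.d. ∼ p_{μ₁}. -/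

import Mathlib

open MeasureTheory ProbabilityTheory Real Set
open scoped ENNReal BigOperators

noncomputable section

namespace SwitchPaper

variable {𝒳 : Type*} [MeasurableSpace 𝒳]

/-- Squared Euclidean distance `‖a − b‖₂²`. -/
def sqDist {m : ℕ} (a b : Fin m → ℝ) : ℝ := ∑ j, (a j - b j) ^ 2

/-- Euclidean inner product. -/
def dot {m : ℕ} (a b : Fin m → ℝ) : ℝ := ∑ j, a j * b j

/-- A CINECSI subset of `M`: a Connected subset of the interior of `M` that is itself
Compact and has NonEmpty interior. -/
def CINECSI {m : ℕ} (M' M : Set (Fin m → ℝ)) : Prop :=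
  IsConnected M' ∧ M' ⊆ interior M ∧ IsCompact M' ∧ (interior M').Nonempty

/-- Hellinger affinity `∫ √(p q) dν = E_{p}[√(q/p)]` between two densities w.r.t. `ν`. -/
def hellingerAffinity (ν : Measure 𝒳) (p q : 𝒳 → ℝ) : ℝ := ∫ x, Real.sqrt (p x * q x) ∂ν

/-- Squared Hellinger distance `d_{H²}(p,q) = 2(1 − E_p[√(q/p)])`. -/
def dH2 (ν : Measure 𝒳) (p q : 𝒳 → ℝ) : ℝ := 2 * (1 - hellingerAffinity ν p q)

/-- Rényi divergence of order 1/2, `d_R(p,q) = −2 log E_p[√(q/p)]`; it is symmetric. -/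
def dRenyiHalf (ν : Measure 𝒳) (p q : 𝒳 → ℝ) : ℝ := -2 * Real.log (hellingerAffinity ν p q)

/-- Kullback–Leibler divergence `D(p‖q) = ∫ p log(p/q) dν` between densities w.r.t. `ν`. -/
def klDiv' (ν : Measure 𝒳) (p q : 𝒳 → ℝ) : ℝ := ∫ x, p x * Real.log (p x / q x) ∂ν

/-- `p : M → 𝒳 → ℝ` is an `m`-dimensional exponential family w.r.t. the base measure `ν`,
given in its mean-value parameterization: the densities have the exponential form
`p_μ(x) = exp(θ(μ)ᵀ φ(x) − ψ(θ(μ))) r(x)`, each `p_μ` is a probability density w.r.t. `ν`,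
the mean of the sufficient statistic `φ` under `p_μ` is `μ`, the parameter set `M` is an
open connected product of open intervals, and the representation is minimal (the components
of `φ`, together with constants, are affinely independent). -/
structure IsMeanValueExpFam {m : ℕ} (ν : Measure 𝒳) (M : Set (Fin m → ℝ))
    (p : (Fin m → ℝ) → 𝒳 → ℝ) (θ : (Fin m → ℝ) → (Fin m → ℝ))
    (φ : 𝒳 → (Fin m → ℝ)) (ψ : (Fin m → ℝ) → ℝ) (carrier : 𝒳 → ℝ) : Prop where
  carrier_pos : ∀ x, 0 < carrier x
  φ_meas : Measurable φ
  p_meas : ∀ μ, Measurable (p μ)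
  M_conn : IsConnected M
  M_prod : ∃ S : Fin m → Set ℝ, (∀ j, IsOpen (S j) ∧ (S j).OrdConnected) ∧ M = Set.univ.pi S
  p_form : ∀ μ ∈ M, ∀ x, p μ x = Real.exp (dot (θ μ) (φ x) - ψ (θ μ)) * carrier x
  p_prob : ∀ μ ∈ M, ∫ x, p μ x ∂ν = 1
  φ_int : ∀ μ ∈ M, Integrable (fun x => (∑ j, |φ x j|) * p μ x) ν
  mean_eq : ∀ μ ∈ M, ∀ i, ∫ x, φ x i * p μ x ∂ν = μ i
  minimal : ∀ c : Fin m → ℝ, ∀ d : ℝ, (∀ x, dot c (φ x) = d) → c = 0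

/-- Covariance matrix of the sufficient statistic `φ` under `p_μ`. -/
def covMatrix {m : ℕ} (ν : Measure 𝒳) (p : (Fin m → ℝ) → 𝒳 → ℝ) (φ : 𝒳 → (Fin m → ℝ))
    (μ : Fin m → ℝ) : Matrix (Fin m) (Fin m) ℝ :=
  Matrix.of fun i j => ∫ x, (φ x i - μ i) * (φ x j - μ j) * p μ x ∂ν

/-- Fisher information matrix in the mean-value parameterization: the inverse of the
covariance matrix of the sufficient statistic. -/
def fisherInfo {m : ℕ} (ν : Measure 𝒳) (p : (Fin m → ℝ) → 𝒳 → ℝ) (φ : 𝒳 → (Fin m → ℝ))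
    (μ : Fin m → ℝ) : Matrix (Fin m) (Fin m) ℝ := (covMatrix ν p φ μ)⁻¹

/-- Quadratic form `vᵀ J v`. -/
def quadForm {m : ℕ} (J : Matrix (Fin m) (Fin m) ℝ) (v : Fin m → ℝ) : ℝ :=
  ∑ i, ∑ j, v i * J i j * v j

/-- Standardized squared error (squared Mahalanobis distance)
`d_ST(a ‖ b) = (b − a)ᵀ I(a) (b − a)`, with `I` the Fisher information. -/
def dST {m : ℕ} (ν : Measure 𝒳) (p : (Fin m → ℝ) → 𝒳 → ℝ) (φ : 𝒳 → (Fin m → ℝ))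
    (a b : Fin m → ℝ) : ℝ := quadForm (fisherInfo ν p φ a) (b - a)

/-- Joint density (likelihood) of an i.i.d. sample. -/
def likelihood {m : ℕ} (p : (Fin m → ℝ) → 𝒳 → ℝ) (μ : Fin m → ℝ) {n : ℕ}
    (xs : Fin n → 𝒳) : ℝ := ∏ i, p μ (xs i)

/-- The law of `n` i.i.d. observations, each with density `f` w.r.t. `ν`. -/
def iidLaw (ν : Measure 𝒳) (f : 𝒳 → ℝ) (n : ℕ) : Measure (Fin n → 𝒳) :=
  (Measure.pi fun _ : Fin n => ν).withDensity fun xs => ENNReal.ofReal (∏ i, f (xs i))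

/-- The (raw) maximum likelihood estimator of an exponential family in its mean-value
parameterization: the empirical mean of the sufficient statistic. -/
def mleRaw {m : ℕ} (φ : 𝒳 → (Fin m → ℝ)) {n : ℕ} (xs : Fin n → 𝒳) : Fin m → ℝ :=
  fun j => (∑ i, φ (xs i) j) / n

/-- Projection `Π₀` onto the simple model: keep the first `m₀` coordinates, replace the
remaining ones by the fixed values. -/
def proj0 {m₁ : ℕ} (m₀ : ℕ) (fixed : Fin m₁ → ℝ) (μ : Fin m₁ → ℝ) : Fin m₁ → ℝ :=
  fun j => if (j : ℕ) < m₀ then μ j else fixed j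

/-- The parameter set of the nested submodel `𝓜₀`: the last `m₁ − m₀` coordinates are
fixed to known values. -/
def nestedSub {m₁ : ℕ} (m₀ : ℕ) (M₁ : Set (Fin m₁ → ℝ)) (fixed : Fin m₁ → ℝ) :
    Set (Fin m₁ → ℝ) := {μ ∈ M₁ | ∀ j : Fin m₁, m₀ ≤ (j : ℕ) → μ j = fixed j}

/-- Embedding of the `m₀`-dimensional parameter of the simple model into `ℝ^{m₁}`. -/
def embed0 {m₀ m₁ : ℕ} (h : m₀ ≤ m₁) (fixed : Fin m₁ → ℝ) (t : Fin m₀ → ℝ) : Fin m₁ → ℝ :=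
  fun j => if hj : (j : ℕ) < m₀ then t ⟨(j : ℕ), hj⟩ else fixed j

/-- Bayes marginal density of a sample: `p_B(xⁿ) = ∫_M w(μ) p_μ(xⁿ) dμ`. -/
def bayesMarginal {m : ℕ} (p : (Fin m → ℝ) → 𝒳 → ℝ) (M : Set (Fin m → ℝ))
    (w : (Fin m → ℝ) → ℝ) {n : ℕ} (xs : Fin n → 𝒳) : ℝ :=
  ∫ μ in M, w μ * likelihood p μ xs

/-- The first `k` observations of a sample of size `n ≥ k`. -/
def prefixObs {n : ℕ} (xs : Fin n → 𝒳) (k : ℕ) (h : k ≤ n) : Fin k → 𝒳 :=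
  fun i => xs (Fin.castLE h i)

/-- The strategy `p̄_t` that switches from the simple to the complex model after `t − 1`
observations: `p̄_t(xⁿ) = p_{B,0}(x^{t−1}) · p_{B,1}(x_t,…,x_n | x^{t−1})`. -/
def pBar (pB0 pB1 : (k : ℕ) → (Fin k → 𝒳) → ℝ) (t : ℕ) {n : ℕ} (xs : Fin n → 𝒳) : ℝ :=
  if h : t - 1 < n then
    pB0 (t - 1) (prefixObs xs (t - 1) h.le) * pB1 n xs / pB1 (t - 1) (prefixObs xs (t - 1) h.le)
  else pB0 n xs

/-- The switch distribution `p_{sw,1}(xⁿ) = Σ_t π(t) p̄_t(xⁿ)`. -/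
def pSwitch (pB0 pB1 : (k : ℕ) → (Fin k → 𝒳) → ℝ) (pri : ℕ → ℝ) {n : ℕ} (xs : Fin n → 𝒳) : ℝ :=
  ∑' t : ℕ, pri t * pBar pB0 pB1 t xs

/-- A prior on switching times supported on powers of two, with `π(2^i) ∝ i^{−κ}`. -/
def SwitchPrior (pri : ℕ → ℝ) (κ : ℝ) : Prop :=
  (∀ t, 0 ≤ pri t) ∧ (∑' t : ℕ, pri t = 1) ∧ (∀ t, pri t ≠ 0 → ∃ i : ℕ, t = 2 ^ i) ∧ 0 < pri 1 ∧
    ∃ c > 0, ∀ i : ℕ, 1 ≤ i → pri (2 ^ i) = c * (i : ℝ) ^ (-κ)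

/-- The event (at sample size `n`) that the switch criterion selects the simple model,
i.e. `p_{sw,1}(xⁿ)/p_{B,0}(xⁿ) ≤ 1`. -/
def swSelectsSimple (pB0 pB1 : (k : ℕ) → (Fin k → 𝒳) → ℝ) (pri : ℕ → ℝ) (n : ℕ) :
    Set (Fin n → 𝒳) := {xs | pSwitch pB0 pB1 pri xs / pB0 n xs ≤ 1}

/-- `small_b(n)`: equal to `1` for `n < b₁` and to `b₂ e^{−b₃ n}` for `n ≥ b₁`. -/
def smallFn (b₁ b₂ b₃ : ℝ) (n : ℕ) : ℝ :=
  if (n : ℝ) < b₁ then 1 else b₂ * Real.exp (-b₃ * n)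

/-- Estimators `μ̆₀, μ̆₁` are sufficiently efficient (with constant `C`, on the set `M₁'`)
w.r.t. the divergence `dgen`: for all `n` and `μ₁ ∈ M₁'`, the risks
`E_{μ₁}[dgen(μ₀, μ̆₀(Xⁿ))]` and `E_{μ₁}[dgen(μ₁, μ̆₁(Xⁿ))]` are bounded by `C/n`,
where `μ₀ = Π₀(μ₁)`. -/
def SuffEff {m₁ : ℕ} (ν : Measure 𝒳) (p : (Fin m₁ → ℝ) → 𝒳 → ℝ) (m₀ : ℕ)
    (fixed : Fin m₁ → ℝ) (M₁' : Set (Fin m₁ → ℝ))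
    (dgen : (Fin m₁ → ℝ) → (Fin m₁ → ℝ) → ℝ)
    (est0 est1 : (n : ℕ) → (Fin n → 𝒳) → (Fin m₁ → ℝ)) (C : ℝ) : Prop :=
  0 < C ∧ ∀ n : ℕ, 0 < n → ∀ μ₁ ∈ M₁',
    (∫ xs, dgen (proj0 m₀ fixed μ₁) (est0 n xs) ∂(iidLaw ν (p μ₁) n)) ≤ C / n ∧
    (∫ xs, dgen μ₁ (est1 n xs) ∂(iidLaw ν (p μ₁) n)) ≤ C / n

end SwitchPaper

namespace SwitchPaper
open Filter Topology
section aux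
variable {𝒳 : Type*} [MeasurableSpace 𝒳] {m : ℕ} {ν : Measure 𝒳} {M : Set (Fin m → ℝ)}
  {p : (Fin m → ℝ) → 𝒳 → ℝ} {θ : (Fin m → ℝ) → (Fin m → ℝ)}
  {φ : 𝒳 → (Fin m → ℝ)} {ψ : (Fin m → ℝ) → ℝ} {carrier : 𝒳 → ℝ}

lemma dot_sub_left' (a b c : Fin m → ℝ) : dot (a - b) c = dot a c - dot b c := by
  simp [dot, sub_mul, Finset.sum_sub_distrib]

lemma dot_add_left' (a b c : Fin m → ℝ) : dot (a + b) c = dot a c + dot b c := by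
  simp [dot, add_mul, Finset.sum_add_distrib]

lemma dot_smul_left' (t : ℝ) (a c : Fin m → ℝ) : dot (t • a) c = t * dot a c := by
  simp [dot, mul_assoc, Finset.mul_sum]

lemma dot_sub_right' (a b c : Fin m → ℝ) : dot a (b - c) = dot a b - dot a c := by
  simp [dot, mul_sub, Finset.sum_sub_distrib]

lemma dot_add_right' (a b c : Fin m → ℝ) : dot a (b + c) = dot a b + dot a c := by
  simp [dot, mul_add, Finset.sum_add_distrib]

lemma dot_smul_right' (t : ℝ) (a c : Fin m → ℝ) : dot a (t • c) = t * dot a c := by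
  simp [dot, Finset.mul_sum, mul_left_comm]

lemma dot_single_left (j : Fin m) (t : ℝ) (c : Fin m → ℝ) : dot (Pi.single j t) c = t * c j := by
  simp [dot, Pi.single_apply]

lemma dot_single_right (j : Fin m) (t : ℝ) (c : Fin m → ℝ) : dot c (Pi.single j t) = c j * t := by
  simp [dot, Pi.single_apply]

lemma abs_dot_le (a b : Fin m → ℝ) : |dot a b| ≤ m * ‖a‖ * ‖b‖ := by
  unfold dot
  refine (Finset.abs_sum_le_sum_abs _ _).trans ?_
  have : ∀ j ∈ Finset.univ, |a j * b j| ≤ ‖a‖ * ‖b‖ := by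
    intro j _
    rw [abs_mul]
    exact mul_le_mul (norm_le_pi_norm a j) (norm_le_pi_norm b j) (abs_nonneg _) (norm_nonneg _)
  refine (Finset.sum_le_sum this).trans ?_
  simp [mul_assoc]

lemma continuous_dot : Continuous (fun q : (Fin m → ℝ) × (Fin m → ℝ) => dot q.1 q.2) := by
  unfold dot; fun_prop

lemma measurable_dot (hφ : Measurable φ) (c : Fin m → ℝ) : Measurable (fun x => dot c (φ x)) := by
  unfold dot
  refine Finset.measurable_sum _ (fun j _ => ?_)
  exact (((measurable_pi_apply j).comp hφ)).const_mul _

/-- negative entropy -/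
def FF (θ : (Fin m → ℝ) → (Fin m → ℝ)) (ψ : (Fin m → ℝ) → ℝ) (μ : Fin m → ℝ) : ℝ :=
  dot (θ μ) μ - ψ (θ μ)

lemma M_open (hF : IsMeanValueExpFam ν M p θ φ ψ carrier) : IsOpen M := by
  obtain ⟨S, hS, rfl⟩ := hF.M_prod
  exact isOpen_set_pi Set.finite_univ (fun j _ => (hS j).1)

lemma M_convex (hF : IsMeanValueExpFam ν M p θ φ ψ carrier) : Convex ℝ M := by
  obtain ⟨S, hS, rfl⟩ := hF.M_prod
  exact convex_pi (fun j _ => (hS j).2.convex)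

lemma p_int (hF : IsMeanValueExpFam ν M p θ φ ψ carrier) {a} (ha : a ∈ M) :
    Integrable (p a) ν := by
  by_contra h
  have := hF.p_prob a ha
  rw [integral_undef h] at this
  norm_num at this

lemma p_pos (hF : IsMeanValueExpFam ν M p θ φ ψ carrier) {a} (ha : a ∈ M) (x) : 0 < p a x := by
  rw [hF.p_form a ha]; exact mul_pos (exp_pos _) (hF.carrier_pos x)

lemma carrier_meas (hF : IsMeanValueExpFam ν M p θ φ ψ carrier) : Measurable carrier := by
  obtain ⟨a, ha⟩ := hF.M_conn.nonempty
  have : carrier = fun x => p a x * Real.exp (-(dot (θ a) (φ x) - ψ (θ a))) := by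
    ext x
    rw [hF.p_form a ha, mul_assoc, mul_comm (carrier x), ← mul_assoc, ← Real.exp_add]
    simp
  rw [this]
  exact (hF.p_meas a).mul (((measurable_dot hF.φ_meas _).sub_const _).neg.exp)

lemma phi_int (hF : IsMeanValueExpFam ν M p θ φ ψ carrier) {a} (ha : a ∈ M) (j) :
    Integrable (fun x => φ x j * p a x) ν := by
  refine (hF.φ_int a ha).mono
    ((((measurable_pi_apply j).comp hF.φ_meas).mul (hF.p_meas a)).aestronglyMeasurable) ?_
  refine Eventually.of_forall (fun x => ?_)
  have h0 := p_pos hF ha x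
  rw [norm_mul, norm_mul]
  refine mul_le_mul_of_nonneg_right ?_ (norm_nonneg _)
  have := Finset.single_le_sum (f := fun i => |φ x i|) (fun i _ => abs_nonneg _) (Finset.mem_univ j)
  exact this.trans (le_abs_self _)

lemma dot_int (hF : IsMeanValueExpFam ν M p θ φ ψ carrier) {a} (ha : a ∈ M) (c : Fin m → ℝ) :
    Integrable (fun x => dot c (φ x) * p a x) ν := by
  have : (fun x => dot c (φ x) * p a x) = fun x => ∑ j, c j * (φ x j * p a x) := by
    ext x; simp [dot, Finset.sum_mul, mul_assoc]
  rw [this]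
  exact integrable_finsetSum _ (fun j _ => (phi_int hF ha j).const_mul _)

lemma dot_integral (hF : IsMeanValueExpFam ν M p θ φ ψ carrier) {a} (ha : a ∈ M)
    (c : Fin m → ℝ) : ∫ x, dot c (φ x) * p a x ∂ν = dot c a := by
  have : (fun x => dot c (φ x) * p a x) = fun x => ∑ j, c j * (φ x j * p a x) := by
    ext x; simp [dot, Finset.sum_mul, mul_assoc]
  rw [this, integral_finsetSum _ (fun j _ => (phi_int hF ha j).const_mul _)]
  simp [integral_const_mul, hF.mean_eq a ha, dot]

lemma lin_int (hF : IsMeanValueExpFam ν M p θ φ ψ carrier) {a} (ha : a ∈ M) (c : Fin m → ℝ)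
    (d : ℝ) : Integrable (fun x => (dot c (φ x) - d) * p a x) ν := by
  simp only [sub_mul]
  exact (dot_int hF ha c).sub ((p_int hF ha).const_mul d)

lemma lin_integral (hF : IsMeanValueExpFam ν M p θ φ ψ carrier) {a} (ha : a ∈ M) (c : Fin m → ℝ)
    (d : ℝ) : ∫ x, (dot c (φ x) - d) * p a x ∂ν = dot c a - d := by
  simp only [sub_mul]
  rw [integral_sub (dot_int hF ha c) ((p_int hF ha).const_mul d), dot_integral hF ha,
    integral_const_mul, hF.p_prob a ha, mul_one]

lemma expo_meas (hF : IsMeanValueExpFam ν M p θ φ ψ carrier) (c : Fin m → ℝ) (d : ℝ) :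
    Measurable (fun x => Real.exp (dot c (φ x) - d) * carrier x) :=
  (((measurable_dot hF.φ_meas _).sub_const _).exp).mul (carrier_meas hF)

/-- Fenchel–Young / Gibbs. -/
lemma gibbs (hF : IsMeanValueExpFam ν M p θ φ ψ carrier) {a} (ha : a ∈ M) (c : Fin m → ℝ)
    (C : ℝ) (h : ∫⁻ x, ENNReal.ofReal (Real.exp (dot c (φ x) - C) * carrier x) ∂ν ≤ 1) :
    dot c a - C ≤ FF θ ψ a := by
  set g : 𝒳 → ℝ := fun x => Real.exp (dot c (φ x) - C) * carrier x with hg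
  have gpos : ∀ x, 0 ≤ g x := fun x => (mul_pos (exp_pos _) (hF.carrier_pos x)).le
  have gint : Integrable g ν := by
    refine ⟨(expo_meas hF c C).aestronglyMeasurable, ?_⟩
    rw [hasFiniteIntegral_iff_ofReal (Eventually.of_forall gpos)]
    exact h.trans_lt ENNReal.one_lt_top
  have gle : ∫ x, g x ∂ν ≤ 1 := by
    rw [integral_eq_lintegral_of_nonneg_ae (Eventually.of_forall gpos) gint.1]
    exact ENNReal.toReal_le_of_le_ofReal zero_le_one (by simpa using h)
  have key : ∫ x, (dot (c - θ a) (φ x) - (C - ψ (θ a) - 1)) * p a x ∂ν ≤ ∫ x, g x ∂ν := by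
    refine integral_mono (lin_int hF ha _ _) gint (fun x => ?_)
    have h1 : g x = Real.exp (dot (c - θ a) (φ x) - (C - ψ (θ a))) * p a x := by
      rw [hF.p_form a ha, ← mul_assoc, ← Real.exp_add, dot_sub_left']
      simp only [hg]; congr 2; ring
    rw [h1]
    refine mul_le_mul_of_nonneg_right ?_ (p_pos hF ha x).le
    have := Real.add_one_le_exp (dot (c - θ a) (φ x) - (C - ψ (θ a)))
    linarith
  rw [lin_integral hF ha, dot_sub_left'] at key
  unfold FF
  linarith

lemma lint_p (hF : IsMeanValueExpFam ν M p θ φ ψ carrier) {a} (ha : a ∈ M) :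
    ∫⁻ x, ENNReal.ofReal (p a x) ∂ν = 1 := by
  rw [← ofReal_integral_eq_lintegral_ofReal (p_int hF ha)
    (Eventually.of_forall (fun x => (p_pos hF ha x).le)), hF.p_prob a ha]
  simp

/-- Subgradient inequality. -/
lemma subgrad (hF : IsMeanValueExpFam ν M p θ φ ψ carrier) {a b} (ha : a ∈ M) (hb : b ∈ M) :
    FF θ ψ b + dot (θ b) (a - b) ≤ FF θ ψ a := by
  have := gibbs hF ha (θ b) (ψ (θ b)) (by
    have := lint_p hF hb
    simp only [hF.p_form b hb] at this
    exact this.le)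
  rw [dot_sub_right']
  unfold FF at *
  linarith

lemma FF_convex (hF : IsMeanValueExpFam ν M p θ φ ψ carrier) : ConvexOn ℝ M (FF θ ψ) := by
  refine ⟨M_convex hF, ?_⟩
  intro x hx y hy s t hs ht hst
  have hz := M_convex hF hx hy hs ht hst
  set z := s • x + t • y with hzd
  have h1 := subgrad hF hx hz
  have h2 := subgrad hF hy hz
  have h3 : s * dot (θ z) (x - z) + t * dot (θ z) (y - z) = 0 := by
    rw [← dot_smul_right', ← dot_smul_right', ← dot_add_right']
    have : s • (x - z) + t • (y - z) = 0 := by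
      rw [smul_sub, smul_sub]
      have : s • z + t • z = z := by rw [← add_smul, hst, one_smul]
      calc s • x - s • z + (t • y - t • z) = (s • x + t • y) - (s • z + t • z) := by abel
        _ = 0 := by rw [this, ← hzd, sub_self]
    rw [this]; simp [dot]
  simp only [smul_eq_mul]
  have e : FF θ ψ z = s * FF θ ψ z + t * FF θ ψ z := by rw [← add_mul, hst, one_mul]
  nlinarith [mul_le_mul_of_nonneg_left h1 hs, mul_le_mul_of_nonneg_left h2 ht]

lemma FF_cont (hF : IsMeanValueExpFam ν M p θ φ ψ carrier) : ContinuousOn (FF θ ψ) M :=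
  (FF_convex hF).continuousOn (M_open hF)

/-- compact enlargement -/
lemma enlarge {K : Set (Fin m → ℝ)} (hK : IsCompact K) (hM : IsOpen M) (hKM : K ⊆ M) :
    ∃ r > 0, ∃ K', IsCompact K' ∧ K ⊆ K' ∧ K' ⊆ M ∧ ∀ a ∈ K, ∀ b, ‖b - a‖ ≤ r → b ∈ K' := by
  obtain ⟨r, hr, h⟩ := hK.exists_cthickening_subset_open hM hKM
  refine ⟨r, hr, _, hK.cthickening (r := r), Metric.self_subset_cthickening _, h, ?_⟩
  intro a ha b hb
  exact Metric.mem_cthickening_of_dist_le b a r K ha (by rwa [dist_eq_norm])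

lemma theta_bdd (hF : IsMeanValueExpFam ν M p θ φ ψ carrier) {K : Set (Fin m → ℝ)}
    (hK : IsCompact K) (hKM : K ⊆ M) :
    ∃ B > 0, ∀ b ∈ K, ‖θ b‖ ≤ B ∧ |ψ (θ b)| ≤ B ∧ ‖b‖ ≤ B := by
  obtain ⟨r, hr, K', hK', hKK', hK'M, hball⟩ := enlarge hK (M_open hF) hKM
  obtain ⟨B₁, hB₁⟩ := hK'.exists_bound_of_continuousOn ((FF_cont hF).mono hK'M)
  obtain ⟨B₂, hB₂⟩ := hK.exists_bound_of_continuousOn (f := fun b => b) continuousOn_id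
  set B₃ := 2 * |B₁| / r with hB₃
  have hθ : ∀ b ∈ K, ‖θ b‖ ≤ B₃ := by
    intro b hb
    rw [pi_norm_le_iff_of_nonneg (by positivity)]
    intro j
    have key : ∀ t : ℝ, |t| ≤ r → θ b j * t ≤ 2 * |B₁| := by
      intro t ht
      have hb' : b + Pi.single j t ∈ K' := hball b hb _ (by
        simpa [Pi.norm_single] using ht)
      have h1 := subgrad hF (hK'M hb') (hKM hb)
      rw [add_sub_cancel_left, dot_single_right] at h1
      have h2 := hB₁ _ hb'
      have h3 := hB₁ _ (hKK' hb)
      rw [Real.norm_eq_abs, abs_le] at h2 h3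
      have := le_abs_self B₁
      linarith
    rw [Real.norm_eq_abs, hB₃, le_div_iff₀ hr]
    rcases abs_cases (θ b j) with h | h
    · rw [h.1]; exact key r (by rw [abs_of_pos hr])
    · rw [h.1]; have := key (-r) (by rw [abs_neg, abs_of_pos hr]); linarith
  refine ⟨B₃ + (m * B₃ * |B₂| + |B₁|) + |B₂| + 1, by positivity, fun b hb => ?_⟩
  have h1 := hθ b hb
  have h2 : ‖b‖ ≤ |B₂| := (hB₂ b hb).trans (le_abs_self _)
  have h3 : |ψ (θ b)| ≤ m * B₃ * |B₂| + |B₁| := by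
    have e : ψ (θ b) = dot (θ b) b - FF θ ψ b := by unfold FF; ring
    rw [e]
    refine (abs_sub _ _).trans (add_le_add ((abs_dot_le _ _).trans ?_) ?_)
    · gcongr
    · exact (hB₁ b (hKK' hb)).trans (le_abs_self _)
  have hB₃0 : 0 ≤ B₃ := by positivity
  have hx : 0 ≤ m * B₃ * |B₂| + |B₁| := by positivity
  have := abs_nonneg B₂
  refine ⟨by linarith, by linarith, by linarith⟩

lemma lsc_lintegral {E : Type*} [TopologicalSpace E] [FirstCountableTopology E]
    (f : E → 𝒳 → ℝ≥0∞) (hm : ∀ e, Measurable (f e)) (hc : ∀ x, Continuous (fun e => f e x)) :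
    LowerSemicontinuous (fun e => ∫⁻ x, f e x ∂ν) := by
  intro e
  change LowerSemicontinuousAt _ e
  rw [lowerSemicontinuousAt_iff_le_liminf]
  calc ∫⁻ x, f e x ∂ν = ∫⁻ x, liminf (fun e' => f e' x) (𝓝 e) ∂ν := by
        congr 1; ext x; exact (((hc x).tendsto e).liminf_eq).symm
    _ ≤ _ := lintegral_liminf_le hm


lemma log_ineq {P Q h L : ℝ} (hQ : 0 < Q) (hP : P = Real.exp L * Q) (h0 : 0 ≤ h) (h1 : h ≤ P)
    (h2 : h ≤ Q) : h * L ^ 2 ≤ (P - Q) * L := by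
  rcases le_total 0 L with hL | hL
  · have : L * Q ≤ P - Q := by
      rw [hP]; nlinarith [Real.add_one_le_exp L]
    calc h * L ^ 2 ≤ Q * L ^ 2 := by gcongr
      _ = (L * Q) * L := by ring
      _ ≤ _ := by gcongr
  · have hQP : Q = Real.exp (-L) * P := by
      rw [hP, ← mul_assoc, ← Real.exp_add]; simp
    have hP0 : 0 ≤ P := h0.trans h1
    have : (-L) * P ≤ Q - P := by
      nlinarith [Real.add_one_le_exp (-L)]
    calc h * L ^ 2 ≤ P * L ^ 2 := by gcongr
      _ = ((-L) * P) * (-L) := by ring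
      _ ≤ (Q - P) * (-L) := mul_le_mul_of_nonneg_right this (by linarith)
      _ = _ := by ring

/-- symmetrised KL lower bound -/
lemma J_lower (hF : IsMeanValueExpFam ν M p θ φ ψ carrier) {a b} (ha : a ∈ M) (hb : b ∈ M)
    (h : 𝒳 → ℝ) (h0 : ∀ x, 0 ≤ h x) (h1 : ∀ x, h x ≤ p a x) (h2 : ∀ x, h x ≤ p b x) :
    ∫⁻ x, ENNReal.ofReal (h x * (dot (θ a - θ b) (φ x) - (ψ (θ a) - ψ (θ b))) ^ 2) ∂ν
      ≤ ENNReal.ofReal (dot (θ a - θ b) (a - b)) := by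
  set c := θ a - θ b with hc
  set d := ψ (θ a) - ψ (θ b) with hd
  have hpt : ∀ x, h x * (dot c (φ x) - d) ^ 2
      ≤ (dot c (φ x) - d) * p a x - (dot c (φ x) - d) * p b x := by
    intro x
    have := log_ineq (L := dot c (φ x) - d) (p_pos hF hb x) (P := p a x) (by
      rw [hF.p_form a ha, hF.p_form b hb, ← mul_assoc, ← Real.exp_add, hc, hd, dot_sub_left']
      congr 2; ring) (h0 x) (h1 x) (h2 x)
    linarith
  have hint : Integrable (fun x => (dot c (φ x) - d) * p a x - (dot c (φ x) - d) * p b x) ν :=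
    (lin_int hF ha c d).sub (lin_int hF hb c d)
  have e : dot c (a - b) = ∫ x, ((dot c (φ x) - d) * p a x - (dot c (φ x) - d) * p b x) ∂ν := by
    rw [integral_sub (lin_int hF ha c d) (lin_int hF hb c d), lin_integral hF ha,
      lin_integral hF hb, dot_sub_right']; ring
  rw [e, ofReal_integral_eq_lintegral_ofReal hint]
  · exact lintegral_mono (fun x => ENNReal.ofReal_le_ofReal (hpt x))
  · exact Eventually.of_forall (fun x => le_trans (mul_nonneg (h0 x) (sq_nonneg _)) (hpt x))

lemma affine_zero (hF : IsMeanValueExpFam ν M p θ φ ψ carrier) (u : Fin m → ℝ) (d : ℝ)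
    (h : ∀ᵐ x ∂ν, dot u (φ x) - d = 0) : u = 0 ∧ d = 0 := by
  have h1 : ∀ a ∈ M, dot u a = d := by
    intro a ha
    have h2 := lin_integral hF ha u d
    rw [integral_eq_zero_of_ae (by filter_upwards [h] with x hx; simp [hx])] at h2
    linarith
  obtain ⟨a, ha⟩ := hF.M_conn.nonempty
  obtain ⟨r, hr, hball⟩ := Metric.isOpen_iff.1 (M_open hF) a ha
  have hu : u = 0 := by
    ext j
    have : a + Pi.single j (r/2) ∈ M := hball (by
      rw [Metric.mem_ball, dist_eq_norm, add_sub_cancel_left, Pi.norm_single, Real.norm_eq_abs,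
        abs_of_pos (by positivity)]
      linarith)
    have h3 := h1 _ this
    rw [dot_add_right', h1 a ha, dot_single_right] at h3
    have : u j * (r/2) = 0 := by linarith
    rcases mul_eq_zero.1 this with h | h
    · exact h
    · linarith
  refine ⟨hu, ?_⟩
  have := h1 a ha
  rw [hu] at this
  simpa [dot] using this.symm

lemma Q_lower (hF : IsMeanValueExpFam ν M p θ φ ψ carrier) (h : 𝒳 → ℝ) (hm : Measurable h)
    (h0 : ∀ x, 0 < h x) :
    ∃ c > 0, ∀ u : Fin m → ℝ, ∀ d : ℝ, ENNReal.ofReal (c * ‖u‖ ^ 2) ≤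
      ∫⁻ x, ENNReal.ofReal (h x * (dot u (φ x) - d) ^ 2) ∂ν := by
  set Q : (Fin m → ℝ) × ℝ → ℝ≥0∞ := fun q =>
    ∫⁻ x, ENNReal.ofReal (h x * (dot q.1 (φ x) - q.2) ^ 2) ∂ν with hQ
  have hmeas : ∀ q : (Fin m → ℝ) × ℝ,
      Measurable (fun x => ENNReal.ofReal (h x * (dot q.1 (φ x) - q.2) ^ 2)) := fun q =>
    (hm.mul (((measurable_dot hF.φ_meas _).sub_const _).pow_const 2)).ennreal_ofReal
  have hlsc : LowerSemicontinuous Q := by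
    refine lsc_lintegral _ hmeas (fun x => ?_)
    refine ENNReal.continuous_ofReal.comp ?_
    unfold dot
    fun_prop
  have hcomp : IsCompact (Metric.sphere (0 : (Fin m → ℝ) × ℝ) 1) := isCompact_sphere _ _
  have hne : (Metric.sphere (0 : (Fin m → ℝ) × ℝ) 1).Nonempty := ⟨(0, 1), by simp [Prod.norm_def]⟩
  obtain ⟨q₀, hq₀, hmin⟩ := (hlsc.lowerSemicontinuousOn _).exists_isMinOn hne hcomp
  have hpos : Q q₀ ≠ 0 := by
    intro hz
    rw [hQ, lintegral_eq_zero_iff (hmeas q₀)] at hz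
    have : ∀ᵐ x ∂ν, dot q₀.1 (φ x) - q₀.2 = 0 := by
      filter_upwards [hz] with x hx
      have hx' : h x * (dot q₀.1 (φ x) - q₀.2) ^ 2 ≤ 0 := by simpa using hx
      have hsq := sq_nonneg (dot q₀.1 (φ x) - q₀.2)
      have : (dot q₀.1 (φ x) - q₀.2) ^ 2 = 0 := by
        by_contra hne
        have := mul_pos (h0 x) (lt_of_le_of_ne hsq (Ne.symm hne))
        linarith
      exact pow_eq_zero_iff (two_ne_zero) |>.1 this
    obtain ⟨h1, h2⟩ := affine_zero hF _ _ this
    have : q₀ = 0 := Prod.ext h1 h2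
    rw [this] at hq₀
    simp at hq₀
  obtain ⟨c, hc, hcQ⟩ : ∃ c : ℝ, 0 < c ∧ ENNReal.ofReal c ≤ Q q₀ := by
    by_cases ht : Q q₀ = ⊤
    · exact ⟨1, one_pos, by rw [ht]; exact le_top⟩
    · exact ⟨(Q q₀).toReal, ENNReal.toReal_pos hpos ht, ENNReal.ofReal_toReal_le⟩
  refine ⟨c, hc, fun u d => ?_⟩
  by_cases hq : ((u, d) : (Fin m → ℝ) × ℝ) = 0
  · have : u = 0 := congrArg Prod.fst hq
    simp [this]
  set s := ‖((u, d) : (Fin m → ℝ) × ℝ)‖ with hs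
  have hspos : 0 < s := norm_pos_iff.2 hq
  have hmem : s⁻¹ • ((u, d) : (Fin m → ℝ) × ℝ) ∈ Metric.sphere (0 : (Fin m → ℝ) × ℝ) 1 := by
    rw [mem_sphere_zero_iff_norm, norm_smul, ← hs, norm_inv, Real.norm_eq_abs, abs_of_pos hspos]
    exact inv_mul_cancel₀ hspos.ne'
  have h1 := hcQ.trans (hmin hmem)
  have h2 : Q (u, d) = ENNReal.ofReal (s ^ 2) * Q (s⁻¹ • (u, d)) := by
    simp only [hQ]
    rw [← lintegral_const_mul _ (hmeas _)]
    congr 1; ext x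
    rw [← ENNReal.ofReal_mul (by positivity)]
    congr 1
    simp only [Prod.smul_mk, dot_smul_left', smul_eq_mul]
    field_simp
  change _ ≤ Q (u, d)
  rw [h2]
  have hle : ‖u‖ ≤ s := norm_fst_le (u, d)
  calc ENNReal.ofReal (c * ‖u‖ ^ 2) ≤ ENNReal.ofReal (s ^ 2 * c) := by
        apply ENNReal.ofReal_le_ofReal
        rw [mul_comm]; gcongr
    _ = ENNReal.ofReal (s ^ 2) * ENNReal.ofReal c := ENNReal.ofReal_mul (by positivity)
    _ ≤ _ := by gcongr

lemma J_ge (hF : IsMeanValueExpFam ν M p θ φ ψ carrier) {K : Set (Fin m → ℝ)}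
    (hK : IsCompact K) (hKM : K ⊆ M) :
    ∃ c > 0, ∀ a ∈ K, ∀ b ∈ K, c * ‖θ a - θ b‖ ^ 2 ≤ dot (θ a - θ b) (a - b) := by
  obtain ⟨B, hB, hbd⟩ := theta_bdd hF hK hKM
  set h : 𝒳 → ℝ := fun x => Real.exp (-(m * B * ‖φ x‖) - B) * carrier x with hh
  have hp : ∀ b ∈ K, ∀ x, h x ≤ p b x := by
    intro b hb x
    rw [hF.p_form b (hKM hb)]
    have h1 := abs_le.1 ((abs_dot_le (θ b) (φ x)))
    have h2 := hbd b hb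
    have h3 := abs_le.1 h2.2.1
    have h4 : m * ‖θ b‖ * ‖φ x‖ ≤ m * B * ‖φ x‖ := by gcongr; exact h2.1
    refine mul_le_mul_of_nonneg_right (Real.exp_le_exp.2 ?_) (hF.carrier_pos x).le
    linarith
  have h0 : ∀ x, 0 < h x := fun x => mul_pos (exp_pos _) (hF.carrier_pos x)
  have hm : Measurable h := by
    have := hF.φ_meas.norm
    have := carrier_meas hF
    fun_prop
  obtain ⟨c, hc, hcQ⟩ := Q_lower hF h hm h0
  refine ⟨c, hc, fun a ha b hb => ?_⟩
  have h1 := (hcQ (θ a - θ b) (ψ (θ a) - ψ (θ b))).trans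
    (J_lower hF (hKM ha) (hKM hb) h (fun x => (h0 x).le) (hp a ha) (hp b hb))
  by_cases hz : c * ‖θ a - θ b‖ ^ 2 ≤ 0
  · have s1 := subgrad hF (hKM ha) (hKM hb)
    have s2 := subgrad hF (hKM hb) (hKM ha)
    rw [dot_sub_right'] at s1 s2
    rw [dot_sub_left', dot_sub_right', dot_sub_right']
    linarith
  · push Not at hz
    exact (ENNReal.ofReal_le_ofReal_iff'.1 h1).resolve_right (not_le.2 hz)

lemma theta_cont (hF : IsMeanValueExpFam ν M p θ φ ψ carrier) : ContinuousOn θ M := by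
  intro b hb
  obtain ⟨r, hr, K, hK, hKK, hKM, hball⟩ := enlarge (K := {b}) isCompact_singleton (M_open hF)
    (by simpa using hb)
  obtain ⟨c, hc, hJ⟩ := J_ge hF hK hKM
  have hbK : b ∈ K := hKK rfl
  have hL : ∀ a ∈ K, ‖θ a - θ b‖ ≤ m / c * ‖a - b‖ := by
    intro a ha
    have h1 := (hJ a ha b hbK).trans ((le_abs_self _).trans (abs_dot_le _ _))
    by_cases hz : ‖θ a - θ b‖ = 0
    · rw [hz]; positivity
    · have hp : 0 < ‖θ a - θ b‖ := lt_of_le_of_ne (norm_nonneg _) (Ne.symm hz)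
      rw [div_mul_eq_mul_div, le_div_iff₀ hc]
      nlinarith
  apply ContinuousAt.continuousWithinAt
  rw [ContinuousAt, tendsto_iff_norm_sub_tendsto_zero]
  have hev : ∀ᶠ a in 𝓝 b, ‖θ a - θ b‖ ≤ m / c * ‖a - b‖ := by
    filter_upwards [Metric.closedBall_mem_nhds b hr] with a ha
    exact hL a (hball b rfl a (by simpa [dist_eq_norm] using ha))
  refine squeeze_zero' (Eventually.of_forall (fun _ => norm_nonneg _)) hev ?_
  have : Continuous (fun a : Fin m → ℝ => m / c * ‖a - b‖) := by fun_prop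
  have := this.tendsto b
  simpa using this

lemma psi_cont (hF : IsMeanValueExpFam ν M p θ φ ψ carrier) :
    ContinuousOn (fun b => ψ (θ b)) M := by
  have : (fun b => ψ (θ b)) = fun b => dot (θ b) b - FF θ ψ b := by
    ext b; unfold FF; ring
  rw [this]
  exact (continuous_dot.comp_continuousOn ((theta_cont hF).prodMk continuousOn_id)).sub (FF_cont hF)

lemma J_pos (hF : IsMeanValueExpFam ν M p θ φ ψ carrier) {a b} (ha : a ∈ M) (hb : b ∈ M)
    (hab : a ≠ b) : 0 < dot (θ a - θ b) (a - b) := by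
  obtain ⟨c, hc, hJ⟩ := J_ge hF (K := {a, b}) (by simp) (by
    rintro x (rfl | rfl) <;> assumption)
  have h1 := hJ a (by simp) b (by simp)
  refine lt_of_lt_of_le ?_ h1
  have : θ a - θ b ≠ 0 := by
    intro h
    apply hab
    have h' := sub_eq_zero.1 h
    have : p a = p b := by
      ext x; rw [hF.p_form a ha, hF.p_form b hb, h']
    ext j
    rw [← hF.mean_eq a ha, ← hF.mean_eq b hb, this]
  have := norm_pos_iff.2 this
  positivity

lemma exp_moment (hF : IsMeanValueExpFam ν M p θ φ ψ carrier) {K : Set (Fin m → ℝ)}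
    (hK : IsCompact K) (hKM : K ⊆ M) :
    ∃ σ > 0, ∃ C : ℝ, ∀ b ∈ K, ∀ j, ∀ t : ℝ, |t| ≤ σ →
      ∫⁻ x, ENNReal.ofReal (Real.exp (dot (θ b + Pi.single j t) (φ x)) * carrier x) ∂ν
        ≤ ENNReal.ofReal C := by
  obtain ⟨r, hr, K', hK', hKK', hK'M, hball⟩ := enlarge hK (M_open hF) hKM
  obtain ⟨B, hB, hbd⟩ := theta_bdd hF hK' hK'M
  -- uniform lower bound for J
  obtain ⟨j₀, hj₀, hJ⟩ : ∃ j₀ > 0, ∀ b ∈ K, ∀ b' ∈ K', ‖b' - b‖ = r →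
      j₀ ≤ dot (θ b' - θ b) (b' - b) := by
    set T : Set ((Fin m → ℝ) × (Fin m → ℝ)) := (K ×ˢ K') ∩ {q | ‖q.2 - q.1‖ = r} with hT
    have hTc : IsCompact T := (hK.prod hK').inter_right
      (isClosed_eq (by fun_prop) continuous_const)
    have h1 : ContinuousOn (fun q : (Fin m → ℝ) × (Fin m → ℝ) => θ q.1) T :=
      (theta_cont hF).comp continuousOn_fst (fun q hq => hKM hq.1.1)
    have h2 : ContinuousOn (fun q : (Fin m → ℝ) × (Fin m → ℝ) => θ q.2) T :=
      (theta_cont hF).comp continuousOn_snd (fun q hq => hK'M hq.1.2)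
    have hcont : ContinuousOn (fun q : (Fin m → ℝ) × (Fin m → ℝ) =>
        dot (θ q.2 - θ q.1) (q.2 - q.1)) T :=
      continuous_dot.comp_continuousOn ((h2.sub h1).prodMk (by fun_prop))
    rcases T.eq_empty_or_nonempty with hE | hne
    · refine ⟨1, one_pos, fun b hb b' hb' hbb => ?_⟩
      have : (b, b') ∈ T := ⟨⟨hb, hb'⟩, hbb⟩
      rw [hE] at this; exact this.elim
    · obtain ⟨q, hq, hmin⟩ := hTc.exists_isMinOn hne hcont
      refine ⟨_, J_pos hF (hK'M hq.1.2) (hKM hq.1.1) ?_, fun b hb b' hb' hbb =>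
        hmin (show (b, b') ∈ T from ⟨⟨hb, hb'⟩, hbb⟩)⟩
      intro h
      have := hq.2
      simp only [mem_ofPred_eq, h, sub_self, norm_zero] at this
      linarith
  set N : Set (Fin m → ℝ) := {c | ∫⁻ x, ENNReal.ofReal (Real.exp (dot c (φ x)) * carrier x) ∂ν
    ≤ ENNReal.ofReal (Real.exp B)} with hN
  have hmeas : ∀ c : Fin m → ℝ,
      Measurable (fun x => ENNReal.ofReal (Real.exp (dot c (φ x)) * carrier x)) := fun c =>
    (((measurable_dot hF.φ_meas c).exp).mul (carrier_meas hF)).ennreal_ofReal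
  have hNclosed : IsClosed N := by
    have hl : LowerSemicontinuous (fun c : Fin m → ℝ =>
        ∫⁻ x, ENNReal.ofReal (Real.exp (dot c (φ x)) * carrier x) ∂ν) := by
      refine lsc_lintegral _ hmeas (fun x => ENNReal.continuous_ofReal.comp ?_)
      unfold dot; fun_prop
    exact hl.isClosed_preimage _
  have hNconv : Convex ℝ N := by
    intro c hc d hd s t hs ht hst
    simp only [hN, mem_ofPred_eq] at hc hd ⊢
    calc ∫⁻ x, ENNReal.ofReal (Real.exp (dot (s • c + t • d) (φ x)) * carrier x) ∂ν
        ≤ ∫⁻ x, (ENNReal.ofReal s * ENNReal.ofReal (Real.exp (dot c (φ x)) * carrier x)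
            + ENNReal.ofReal t * ENNReal.ofReal (Real.exp (dot d (φ x)) * carrier x)) ∂ν := by
          refine lintegral_mono (fun x => ?_)
          simp only []
          have hx := hF.carrier_pos x
          rw [← ENNReal.ofReal_mul hs, ← ENNReal.ofReal_mul ht, ← ENNReal.ofReal_add
            (by positivity) (by positivity)]
          apply ENNReal.ofReal_le_ofReal
          have := convexOn_exp.2 (mem_univ (dot c (φ x))) (mem_univ (dot d (φ x))) hs ht hst
          simp only [smul_eq_mul] at this
          rw [dot_add_left', dot_smul_left', dot_smul_left']
          calc _ ≤ (s * Real.exp (dot c (φ x)) + t * Real.exp (dot d (φ x))) * carrier x := by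
                gcongr
            _ = _ := by ring
      _ = ENNReal.ofReal s * ∫⁻ x, ENNReal.ofReal (Real.exp (dot c (φ x)) * carrier x) ∂ν
          + ENNReal.ofReal t * ∫⁻ x, ENNReal.ofReal (Real.exp (dot d (φ x)) * carrier x) ∂ν := by
          rw [lintegral_add_left ((hmeas c).const_mul _), lintegral_const_mul _ (hmeas c),
            lintegral_const_mul _ (hmeas d)]
      _ ≤ ENNReal.ofReal s * ENNReal.ofReal (Real.exp B)
          + ENNReal.ofReal t * ENNReal.ofReal (Real.exp B) := by gcongr
      _ = ENNReal.ofReal (Real.exp B) := by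
          rw [← add_mul, ← ENNReal.ofReal_add hs ht, hst]; simp
  have hθN : ∀ b ∈ K', θ b ∈ N := by
    intro b hb
    have h1 := lint_p hF (hK'M hb)
    have h2 : ∀ x, ENNReal.ofReal (Real.exp (dot (θ b) (φ x)) * carrier x)
        = ENNReal.ofReal (Real.exp (ψ (θ b))) * ENNReal.ofReal (p b x) := by
      intro x
      rw [← ENNReal.ofReal_mul (exp_pos _).le, hF.p_form b (hK'M hb), ← mul_assoc, ← Real.exp_add]
      congr 3; ring
    simp only [hN, mem_ofPred_eq, h2]
    rw [lintegral_const_mul _ (hF.p_meas b).ennreal_ofReal, h1, mul_one]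
    exact ENNReal.ofReal_le_ofReal (Real.exp_le_exp.2 ((le_abs_self _).trans (hbd b hb).2.1))
  refine ⟨j₀ / r, by positivity, Real.exp B, fun b hb j t ht => ?_⟩
  by_contra hcon
  have hnot : θ b + Pi.single j t ∉ N := hcon
  obtain ⟨f, u, hfu, hu⟩ := geometric_hahn_banach_closed_point hNconv hNclosed hnot
  set c : Fin m → ℝ := fun i => f (Pi.single i 1) with hc
  have hf : ∀ y, f y = dot y c := by
    intro y
    conv_lhs => rw [← Finset.univ_sum_single y]
    rw [map_sum]
    unfold dot
    refine Finset.sum_congr rfl (fun i _ => ?_)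
    have : (Pi.single i (y i) : Fin m → ℝ) = y i • Pi.single i 1 := by
      ext k; by_cases h : k = i
      · subst h; simp
      · simp [h]
    rw [this, map_smul, smul_eq_mul]
  have hc0 : 0 < ‖c‖ := by
    rw [norm_pos_iff]
    intro h
    have h1 := hfu _ (hθN b (hKK' hb))
    rw [hf, h] at h1 hu
    simp [dot] at h1 hu
    linarith
  set b' := b + (r / ‖c‖) • c with hb'
  have hnorm : ‖b' - b‖ = r := by
    rw [hb', add_sub_cancel_left, norm_smul, Real.norm_eq_abs, abs_of_pos (by positivity)]
    field_simp
  have hb'K : b' ∈ K' := hball b hb b' hnorm.le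
  have hJ' := hJ b hb b' hb'K hnorm
  have h1 := hfu _ (hθN b' hb'K)
  rw [map_add, hf, hf, dot_single_left] at hu
  rw [hf] at h1
  have h2 : dot (θ b' - θ b) c < j₀ / r * ‖c‖ := by
    rw [dot_sub_left']
    have : t * c j ≤ j₀ / r * ‖c‖ := by
      refine (le_abs_self _).trans ?_
      rw [abs_mul]
      exact mul_le_mul ht (norm_le_pi_norm c j) (abs_nonneg _) (by positivity)
    linarith
  have h3 : dot (θ b' - θ b) (b' - b) < j₀ := by
    rw [hb', add_sub_cancel_left, dot_smul_right', ← hb']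
    calc r / ‖c‖ * dot (θ b' - θ b) c < r / ‖c‖ * (j₀ / r * ‖c‖) := by gcongr
      _ = j₀ := by field_simp
  linarith

lemma exp_quad {σ t y : ℝ} (hσ : 0 < σ) (ht : |t| ≤ σ / 2) :
    Real.exp (t * y) ≤ 1 + t * y + 8 / σ ^ 2 * t ^ 2 * Real.exp (σ * |y|) := by
  have h1 : Real.exp (t * y) ≤ 1 + t * y + (t * y) ^ 2 * Real.exp |t * y| := by
    have := Complex.norm_exp_sub_sum_le_norm_mul_exp ((t * y : ℝ) : ℂ) 2
    rw [show Complex.exp ((t * y : ℝ) : ℂ) - ∑ i ∈ Finset.range 2, ((t * y : ℝ) : ℂ) ^ i / (i.factorial : ℂ)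
      = ((Real.exp (t * y) - (1 + t * y) : ℝ) : ℂ) by simp [Finset.sum_range_succ],
      Complex.norm_real, Complex.norm_real, Real.norm_eq_abs, Real.norm_eq_abs, sq_abs] at this
    have := (abs_le.1 this).2
    linarith
  have h2 : |t * y| ≤ σ * |y| / 2 := by
    rw [abs_mul]
    have := mul_le_mul_of_nonneg_right ht (abs_nonneg y)
    linarith
  have h3 : y ^ 2 ≤ 8 / σ ^ 2 * Real.exp (σ * |y| / 2) := by
    have h4 := Real.quadratic_le_exp_of_nonneg (x := σ * |y| / 2) (by positivity)
    have h5 : 8 / σ ^ 2 * ((σ * |y| / 2) ^ 2 / 2) = y ^ 2 := by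
      field_simp
      rw [sq_abs]; ring
    rw [← h5]
    gcongr
    have : 0 ≤ σ * |y| / 2 := by positivity
    linarith
  calc _ ≤ _ := h1
    _ ≤ 1 + t * y + t ^ 2 * (8 / σ ^ 2 * Real.exp (σ * |y| / 2)) * Real.exp (σ * |y| / 2) := by
      rw [mul_pow]; gcongr
    _ = 1 + t * y + 8 / σ ^ 2 * t ^ 2 * (Real.exp (σ * |y| / 2) * Real.exp (σ * |y| / 2)) := by ring
    _ = _ := by rw [← Real.exp_add]; ring_nf

lemma mgf_bound (hF : IsMeanValueExpFam ν M p θ φ ψ carrier) {K : Set (Fin m → ℝ)}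
    (hK : IsCompact K) (hKM : K ⊆ M) :
    ∃ κ > 0, ∃ s₀ > 0, ∀ b ∈ K, ∀ j, ∀ t : ℝ, |t| ≤ s₀ →
      ∫⁻ x, ENNReal.ofReal (Real.exp (t * (φ x j - b j)) * p b x) ∂ν
        ≤ ENNReal.ofReal (Real.exp (κ * t ^ 2)) := by
  obtain ⟨σ, hσ, C, hC⟩ := exp_moment hF hK hKM
  obtain ⟨B, hB, hbd⟩ := theta_bdd hF hK hKM
  have hmφ : ∀ j, Measurable (fun x => φ x j) := fun j => (measurable_pi_apply j).comp hF.φ_meas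
  set C' := Real.exp (σ * B + B) * |C| with hC'
  have h1 : ∀ b ∈ K, ∀ j, ∀ t : ℝ, |t| ≤ σ →
      ∫⁻ x, ENNReal.ofReal (Real.exp (t * (φ x j - b j)) * p b x) ∂ν ≤ ENNReal.ofReal C' := by
    intro b hb j t ht
    have h2 : ∀ x, ENNReal.ofReal (Real.exp (t * (φ x j - b j)) * p b x) ≤
        ENNReal.ofReal (Real.exp (σ * B + B)) *
          ENNReal.ofReal (Real.exp (dot (θ b + Pi.single j t) (φ x)) * carrier x) := by
      intro x
      rw [← ENNReal.ofReal_mul (exp_pos _).le, hF.p_form b (hKM hb), ← mul_assoc, ← mul_assoc,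
        ← Real.exp_add, ← Real.exp_add]
      apply ENNReal.ofReal_le_ofReal
      refine mul_le_mul_of_nonneg_right (Real.exp_le_exp.2 ?_) (hF.carrier_pos x).le
      rw [dot_add_left', dot_single_left]
      have h3 := abs_le.1 (hbd b hb).2.1
      have h4 : |t * b j| ≤ σ * B := by
        rw [abs_mul]
        exact mul_le_mul ht ((norm_le_pi_norm b j).trans (hbd b hb).2.2) (abs_nonneg _) hσ.le
      have h5 := abs_le.1 h4
      nlinarith
    refine (lintegral_mono h2).trans ?_
    have hmm : Measurable (fun x => ENNReal.ofReal
        (Real.exp (dot (θ b + Pi.single j t) (φ x)) * carrier x)) :=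
      (((measurable_dot hF.φ_meas _).exp).mul (carrier_meas hF)).ennreal_ofReal
    rw [lintegral_const_mul _ hmm]
    rw [hC', ENNReal.ofReal_mul (exp_pos _).le]
    gcongr
    exact (hC b hb j t ht).trans (ENNReal.ofReal_le_ofReal (le_abs_self _))
  have hC'0 : 0 ≤ C' := by positivity
  refine ⟨8 / σ ^ 2 * (2 * C') + 1, by positivity, σ / 2, by positivity, fun b hb j t ht => ?_⟩
  have hbM := hKM hb
  set E : 𝒳 → ℝ := fun x => Real.exp (σ * |φ x j - b j|) * p b x with hE
  have hE0 : ∀ x, 0 ≤ E x := fun x => (mul_pos (exp_pos _) (p_pos hF hbM x)).le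
  have hEm : Measurable E := by
    have := hmφ j
    have := hF.p_meas b
    fun_prop
  have hEl : ∫⁻ x, ENNReal.ofReal (E x) ∂ν ≤ ENNReal.ofReal (2 * C') := by
    calc ∫⁻ x, ENNReal.ofReal (E x) ∂ν
        ≤ ∫⁻ x, (ENNReal.ofReal (Real.exp (σ * (φ x j - b j)) * p b x)
          + ENNReal.ofReal (Real.exp ((-σ) * (φ x j - b j)) * p b x)) ∂ν := by
          refine lintegral_mono (fun x => ?_)
          have hp := (p_pos hF hbM x)
          simp only []
          rw [← ENNReal.ofReal_add (by positivity) (by positivity), ← add_mul]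
          apply ENNReal.ofReal_le_ofReal
          refine mul_le_mul_of_nonneg_right ?_ hp.le
          rcases abs_cases (φ x j - b j) with h | h
          · rw [h.1]; linarith [exp_pos ((-σ) * (φ x j - b j))]
          · rw [h.1, mul_neg, ← neg_mul]; linarith [exp_pos (σ * (φ x j - b j))]
      _ = _ + _ := lintegral_add_left (by
          have := hmφ j
          have := hF.p_meas b
          fun_prop) _
      _ ≤ ENNReal.ofReal C' + ENNReal.ofReal C' :=
          add_le_add (h1 b hb j σ (by rw [abs_of_pos hσ]))
            (h1 b hb j (-σ) (by rw [abs_neg, abs_of_pos hσ]))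
      _ = _ := by rw [← ENNReal.ofReal_add hC'0 hC'0, two_mul]
  have hEi : Integrable E ν := by
    refine ⟨hEm.aestronglyMeasurable, ?_⟩
    rw [hasFiniteIntegral_iff_ofReal (Eventually.of_forall hE0)]
    exact hEl.trans_lt ENNReal.ofReal_lt_top
  have hEI : ∫ x, E x ∂ν ≤ 2 * C' := by
    rw [integral_eq_lintegral_of_nonneg_ae (Eventually.of_forall hE0) hEi.1]
    exact ENNReal.toReal_le_of_le_ofReal (by positivity) hEl
  set a₂ := 8 / σ ^ 2 * t ^ 2 with ha₂
  have ha₂0 : 0 ≤ a₂ := by positivity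
  set G : 𝒳 → ℝ := fun x => (dot (Pi.single j t) (φ x) - (t * b j - 1)) * p b x + a₂ * E x with hG
  have hGi : Integrable G ν := (lin_int hF hbM _ _).add (hEi.const_mul _)
  have hGI : ∫ x, G x ∂ν ≤ 1 + a₂ * (2 * C') := by
    rw [hG, integral_add (lin_int hF hbM _ _) (hEi.const_mul _), lin_integral hF hbM,
      integral_const_mul, dot_single_left]
    have := mul_le_mul_of_nonneg_left hEI ha₂0
    linarith
  have hpt : ∀ x, Real.exp (t * (φ x j - b j)) * p b x ≤ G x := by
    intro x
    have := mul_le_mul_of_nonneg_right (exp_quad (y := φ x j - b j) hσ ht) (p_pos hF hbM x).le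
    refine this.trans (le_of_eq ?_)
    simp only [hG, hE, dot_single_left, ha₂]; ring
  have hG0 : ∀ x, 0 ≤ G x := fun x =>
    (mul_pos (exp_pos _) (p_pos hF hbM x)).le.trans (hpt x)
  calc _ ≤ ∫⁻ x, ENNReal.ofReal (G x) ∂ν :=
        lintegral_mono (fun x => ENNReal.ofReal_le_ofReal (hpt x))
    _ = ENNReal.ofReal (∫ x, G x ∂ν) :=
        (ofReal_integral_eq_lintegral_ofReal hGi (Eventually.of_forall hG0)).symm
    _ ≤ _ := by
        apply ENNReal.ofReal_le_ofReal
        refine hGI.trans (le_trans ?_ (Real.add_one_le_exp _))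
        rw [ha₂]
        nlinarith [sq_nonneg t]

def DD (θ : (Fin m → ℝ) → (Fin m → ℝ)) (ψ : (Fin m → ℝ) → ℝ) (a b : Fin m → ℝ) : ℝ :=
  FF θ ψ a - FF θ ψ b - dot (θ b) (a - b)

lemma DD_nonneg (hF : IsMeanValueExpFam ν M p θ φ ψ carrier) {a b : Fin m → ℝ} (ha : a ∈ M)
    (hb : b ∈ M) : 0 ≤ DD θ ψ a b := by
  have := subgrad hF ha hb
  unfold DD; linarith

lemma DD_ray (hF : IsMeanValueExpFam ν M p θ φ ψ carrier) {a b : Fin m → ℝ}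
    (hb : b ∈ M) {s : ℝ} (hs0 : 0 < s) (hs : s < 1) (hb' : a + s • (b - a) ∈ M) :
    DD θ ψ a (a + s • (b - a)) ≤ DD θ ψ a b := by
  set b' := a + s • (b - a) with hbd
  have h1 := subgrad hF hb' hb
  have h2 := subgrad hF hb hb'
  have e1 : b' - b = (-(1 - s)) • (b - a) := by rw [hbd]; ext j; simp; ring
  have e2 : b - b' = (1 - s) • (b - a) := by rw [hbd]; ext j; simp; ring
  have e3 : a - b' = (-s) • (b - a) := by rw [hbd]; ext j; simp
  have e4 : a - b = (-1 : ℝ) • (b - a) := by ext j; simp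
  unfold DD
  rw [e3, e4]
  rw [e1] at h1
  rw [e2] at h2
  simp only [dot_smul_right'] at *
  have h3 : dot (θ b') (b - a) ≤ dot (θ b) (b - a) := by nlinarith
  nlinarith

lemma DD_lower (hF : IsMeanValueExpFam ν M p θ φ ψ carrier) {K : Set (Fin m → ℝ)}
    (hK : IsCompact K) (hKM : K ⊆ M) :
    ∃ c > 0, ∃ ρ > 0, ∀ a ∈ K, ∀ b ∈ M, ∀ j, c * min ((a j - b j) ^ 2) (ρ ^ 2 * (a j - b j) ^ 2 / ‖b - a‖ ^ 2) ≤ DD θ ψ a b := by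
  obtain ⟨r, hr, K', hK', hKK', hK'M, hen⟩ := enlarge hK (M_open hF) hKM
  obtain ⟨κ, hκ, s₀, hs₀, hmgf⟩ := mgf_bound hF hK' hK'M
  set s := min (s₀ / r) (1 / (2 * κ)) with hsdef
  have hs : 0 < s := by positivity
  have near : ∀ a ∈ K, ∀ b, ‖b - a‖ ≤ r → ∀ j, s / 2 * (a j - b j) ^ 2 ≤ DD θ ψ a b := by
    intro a ha b hab j
    have hbK := hen a ha b hab
    have hbM := hK'M hbK
    have hj : |a j - b j| ≤ r := by
      have := norm_le_pi_norm (b - a) j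
      rw [Pi.sub_apply, Real.norm_eq_abs, abs_sub_comm] at this
      linarith
    set t := s * (a j - b j) with ht
    have ht0 : |t| ≤ s₀ := by
      rw [ht, abs_mul, abs_of_pos hs]
      calc s * |a j - b j| ≤ s₀ / r * r := by
            gcongr
            exact min_le_left _ _
        _ = s₀ := by field_simp
    have h1 := hmgf b hbK j t ht0
    have h2 := gibbs hF (hKM ha) (θ b + Pi.single j t) (ψ (θ b) + t * b j + κ * t ^ 2) (by
      have : ∀ x, ENNReal.ofReal (Real.exp (dot (θ b + Pi.single j t) (φ x) -
          (ψ (θ b) + t * b j + κ * t ^ 2)) * carrier x) = ENNReal.ofReal (Real.exp (- (κ * t ^ 2))) *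
          ENNReal.ofReal (Real.exp (t * (φ x j - b j)) * p b x) := by
        intro x
        rw [← ENNReal.ofReal_mul (exp_pos _).le, hF.p_form b hbM, ← mul_assoc, ← mul_assoc,
          ← Real.exp_add, ← Real.exp_add, dot_add_left', dot_single_left]
        congr 3; ring
      simp_rw [this]
      rw [lintegral_const_mul' _ _ ENNReal.ofReal_ne_top]
      calc _ ≤ ENNReal.ofReal (Real.exp (- (κ * t ^ 2))) * ENNReal.ofReal (Real.exp (κ * t ^ 2)) := by
            gcongr
        _ = 1 := by rw [← ENNReal.ofReal_mul (exp_pos _).le, ← Real.exp_add]; simp)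
    rw [dot_add_left', dot_single_left] at h2
    have h3 : DD θ ψ a b = FF θ ψ a - dot (θ b) a + ψ (θ b) := by
      unfold DD; rw [dot_sub_right']; unfold FF; ring
    have h4 : t * (a j - b j) - κ * t ^ 2 ≤ DD θ ψ a b := by rw [h3]; linarith
    refine le_trans ?_ h4
    have h5 : s * κ ≤ 1 / 2 := by
      have : s ≤ 1 / (2 * κ) := min_le_right _ _
      rw [le_div_iff₀ (by positivity)] at this
      linarith
    have : t * (a j - b j) - κ * t ^ 2 = s * (a j - b j) ^ 2 * (1 - s * κ) := by rw [ht]; ring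
    rw [this]
    have : 0 ≤ s * (a j - b j) ^ 2 := by positivity
    nlinarith
  refine ⟨s / 2, by positivity, r, hr, ?_⟩
  intro a ha b hb j
  by_cases hab : ‖b - a‖ ≤ r
  · refine le_trans ?_ (near a ha b hab j)
    gcongr
    exact min_le_left _ _
  · push Not at hab
    have hn : 0 < ‖b - a‖ := hr.trans hab
    have hq : r / ‖b - a‖ < 1 := (div_lt_one hn).2 hab
    have hq0 : 0 < r / ‖b - a‖ := by positivity
    have hnn : ‖a + (r / ‖b - a‖) • (b - a) - a‖ ≤ r := by
      rw [add_sub_cancel_left, norm_smul, Real.norm_eq_abs, abs_of_pos hq0]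
      field_simp; exact le_refl _
    have h1 := near a ha _ hnn j
    have h2 := DD_ray hF hb hq0 hq (hK'M (hen a ha _ hnn))
    refine le_trans ?_ (h1.trans h2)
    gcongr
    refine (min_le_right _ _).trans (le_of_eq ?_)
    simp; field_simp; ring

lemma DD_sub (hF : IsMeanValueExpFam ν M p θ φ ψ carrier) {K : Set (Fin m → ℝ)}
    (hK : IsCompact K) (hKM : K ⊆ M) (m₀ : ℕ) (fixed : Fin m → ℝ) :
    ∃ c > 0, ∀ a ∈ K, ∀ b ∈ nestedSub m₀ M fixed,
      c * sqDist a (proj0 m₀ fixed a) ≤ DD θ ψ a b := by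
  obtain ⟨c, hc, ρ, hρ, h⟩ := DD_lower hF hK hKM
  obtain ⟨B, hB, hbd⟩ := theta_bdd hF hK hKM
  set S := ∑ j, (B + |fixed j|) ^ 2 + 1 with hS
  have hS0 : 0 < S := by positivity
  set q := min (1 / ((m : ℝ) + 1)) (ρ ^ 2 / S) with hq
  have hq0 : 0 < q := by positivity
  have key : ∀ a ∈ K, sqDist a (proj0 m₀ fixed a) ≤ S := by
    intro a ha
    have : sqDist a (proj0 m₀ fixed a) ≤ ∑ j, (B + |fixed j|) ^ 2 := by
      unfold sqDist
      apply Finset.sum_le_sum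
      intro j _
      unfold proj0
      apply sq_le_sq'
      · split_ifs
        · have := abs_nonneg (fixed j)
          rw [sub_self]; linarith
        · have := (norm_le_pi_norm a j).trans (hbd a ha).2.2
          have := (abs_le.1 this).1
          have := le_abs_self (fixed j)
          linarith
      · split_ifs
        · simp; positivity
        · have := (norm_le_pi_norm a j).trans (hbd a ha).2.2
          have := (abs_le.1 this).2
          have := neg_abs_le (fixed j)
          linarith
    linarith
  refine ⟨c * q, by positivity, ?_⟩
  intro a ha b hb
  have hDn := DD_nonneg hF (hKM ha) hb.1
  by_cases hab : a = b
  · subst hab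
    have : sqDist a (proj0 m₀ fixed a) = 0 := by
      unfold sqDist
      apply Finset.sum_eq_zero
      intro j _
      unfold proj0
      split_ifs with hj
      · simp
      · rw [hb.2 j (not_lt.1 hj)]; simp
    rw [this]; simpa using hDn
  have hn : 0 < ‖b - a‖ := norm_pos_iff.2 (sub_ne_zero.2 (Ne.symm hab))
  -- the max coordinate
  have hne : Nonempty (Fin m) := by
    by_contra hne
    rw [not_nonempty_iff] at hne
    exact hab (Subsingleton.elim _ _)
  obtain ⟨j, -, hj⟩ := Finset.exists_max_image (Finset.univ : Finset (Fin m)) (fun j => ‖(b - a) j‖)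
    Finset.univ_nonempty
  have hnj : ‖b - a‖ = ‖(b - a) j‖ :=
    le_antisymm ((pi_norm_le_iff_of_nonneg (norm_nonneg _)).2 fun i => hj i (Finset.mem_univ _))
      (norm_le_pi_norm _ _)
  have hnj2 : (a j - b j) ^ 2 = ‖b - a‖ ^ 2 := by
    rw [hnj, Real.norm_eq_abs, sq_abs, Pi.sub_apply]; ring
  have h1 := h a ha b hb.1 j
  rw [hnj2] at h1
  rw [mul_div_assoc, div_self (by positivity), mul_one] at h1
  refine le_trans ?_ h1
  rw [mul_assoc]
  gcongr
  refine le_min ?_ ?_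
  · have h2 : sqDist a (proj0 m₀ fixed a) ≤ m * ‖b - a‖ ^ 2 := by
      unfold sqDist
      calc _ ≤ ∑ j : Fin m, ‖b - a‖ ^ 2 := by
            apply Finset.sum_le_sum
            intro j _
            unfold proj0
            split_ifs with hj
            · simp
            · rw [← hb.2 j (not_lt.1 hj)]
              have := norm_le_pi_norm (b - a) j
              rw [Pi.sub_apply, Real.norm_eq_abs] at this
              rw [← sq_abs, abs_sub_comm]
              gcongr
        _ = _ := by simp
    have h0 : 0 ≤ sqDist a (proj0 m₀ fixed a) := by unfold sqDist; positivity
    calc _ ≤ 1 / ((m : ℝ) + 1) * (m * ‖b - a‖ ^ 2) := by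
          gcongr
          exact min_le_left _ _
      _ ≤ 1 / ((m : ℝ) + 1) * ((m + 1) * ‖b - a‖ ^ 2) := by gcongr; linarith
      _ = _ := by field_simp
  · calc _ ≤ ρ ^ 2 / S * S := by
          have h0 : 0 ≤ sqDist a (proj0 m₀ fixed a) := by unfold sqDist; positivity
          exact mul_le_mul (min_le_right _ _) (key a ha) h0 (by positivity)
      _ = _ := by field_simp

lemma DD_upper (hF : IsMeanValueExpFam ν M p θ φ ψ carrier) {a b : Fin m → ℝ} (ha : a ∈ M)
    (hb : b ∈ M) {B : ℝ} (h1 : ‖θ a‖ ≤ B) (h2 : ‖θ b‖ ≤ B) :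
    DD θ ψ a b ≤ 2 * B * m * ‖b - a‖ := by
  have h := subgrad hF hb ha
  have e : a - b = (-1 : ℝ) • (b - a) := by ext j; simp
  have h3 : DD θ ψ a b ≤ dot (θ b - θ a) (b - a) := by
    unfold DD
    rw [e, dot_smul_right', dot_sub_left']
    linarith
  refine h3.trans ((le_abs_self _).trans ((abs_dot_le _ _).trans ?_))
  have : ‖θ b - θ a‖ ≤ 2 * B := (norm_sub_le _ _).trans (by linarith)
  calc _ ≤ (m : ℝ) * (2 * B) * ‖b - a‖ := by gcongr
    _ = _ := by ring

def GG (θ : (Fin m → ℝ) → (Fin m → ℝ)) (ψ : (Fin m → ℝ) → ℝ) (φ : 𝒳 → (Fin m → ℝ))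
    (carrier : 𝒳 → ℝ) {n : ℕ} (xs : Fin n → 𝒳) : ℝ :=
  Real.exp (n * FF θ ψ (mleRaw φ xs)) * ∏ i, carrier (xs i)

lemma GG_pos (hF : IsMeanValueExpFam ν M p θ φ ψ carrier) {n : ℕ} (xs : Fin n → 𝒳) :
    0 < GG θ ψ φ carrier xs :=
  mul_pos (exp_pos _) (Finset.prod_pos fun i _ => hF.carrier_pos _)

lemma lik_form (hF : IsMeanValueExpFam ν M p θ φ ψ carrier) {n : ℕ} (hn : 0 < n)
    (xs : Fin n → 𝒳) {b : Fin m → ℝ} (hb : b ∈ M) :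
    likelihood p b xs = GG θ ψ φ carrier xs * Real.exp (-(n * DD θ ψ (mleRaw φ xs) b)) := by
  have hn' : (n : ℝ) ≠ 0 := by positivity
  unfold likelihood GG
  simp_rw [hF.p_form b hb]
  rw [Finset.prod_mul_distrib, ← Real.exp_sum, mul_right_comm, ← Real.exp_add]
  congr 2
  have h1 : ∑ i, dot (θ b) (φ (xs i)) = n * dot (θ b) (mleRaw φ xs) := by
    unfold dot mleRaw
    rw [Finset.sum_comm, Finset.mul_sum]
    refine Finset.sum_congr rfl fun j _ => ?_
    rw [← Finset.mul_sum]
    field_simp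
  rw [Finset.sum_sub_distrib, h1]
  simp only [DD, dot_sub_right', FF, Finset.sum_const, Finset.card_univ, Fintype.card_fin, nsmul_eq_mul]
  ring

lemma lik_cont (hF : IsMeanValueExpFam ν M p θ φ ψ carrier) {n : ℕ} 
    (xs : Fin n → 𝒳) : ContinuousOn (fun b => likelihood p b xs) M := by
  have : ContinuousOn (fun b => ∏ i, (Real.exp (dot (θ b) (φ (xs i)) - ψ (θ b)) * carrier (xs i))) M := by
    refine continuousOn_finsetProd _ fun i _ => ?_
    refine ContinuousOn.mul (Real.continuous_exp.comp_continuousOn ?_) continuousOn_const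
    exact (continuous_dot.comp_continuousOn ((theta_cont hF).prodMk continuousOn_const)).sub (psi_cont hF)
  refine this.congr fun b hb => ?_
  unfold likelihood
  exact Finset.prod_congr rfl fun i _ => hF.p_form b hb _

lemma lik_pos (hF : IsMeanValueExpFam ν M p θ φ ψ carrier) {n : ℕ} 
    (xs : Fin n → 𝒳) {b : Fin m → ℝ} (hb : b ∈ M) : 0 < likelihood p b xs :=
  Finset.prod_pos fun i _ => p_pos hF hb _

lemma integ_of_one {α : Type*} [MeasurableSpace α] {μ : Measure α} {f : α → ℝ} (h : ∫ x, f x ∂μ = 1) :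
    Integrable f μ := by
  by_contra h'
  rw [integral_undef h'] at h
  norm_num at h

/-- lower bound for the big marginal -/
lemma marg1_lower (hF : IsMeanValueExpFam ν M p θ φ ψ carrier) {K : Set (Fin m → ℝ)}
    (hK : IsCompact K) (hKM : K ⊆ M) {ω : (Fin m → ℝ) → ℝ} (hωc : ContinuousOn ω M)
    (hωp : ∀ b ∈ M, 0 < ω b) (hωi : (∫ b in M, ω b) = 1) :
    ∃ c > 0, ∀ n : ℕ, 0 < n → ∀ xs : Fin n → 𝒳, mleRaw φ xs ∈ K →
      GG θ ψ φ carrier xs * (c * ((n : ℝ) ^ m)⁻¹) ≤ bayesMarginal p M ω xs := by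
  obtain ⟨r, hr, K', hK', hKK', hK'M, hen⟩ := enlarge hK (M_open hF) hKM
  obtain ⟨B, hB, hbd⟩ := theta_bdd hF hK' hK'M
  obtain ⟨w, hw, hwle⟩ : ∃ w > 0, ∀ b ∈ K', w ≤ ω b := by
    rcases K'.eq_empty_or_nonempty with h | h
    · exact ⟨1, one_pos, by simp [h]⟩
    · obtain ⟨b₀, hb₀, hmin⟩ := hK'.exists_isMinOn h (hωc.mono hK'M)
      exact ⟨ω b₀, hωp _ (hK'M hb₀), fun b hb => hmin hb⟩
  set e := 2 * B * m * r with he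
  refine ⟨w * Real.exp (-e) * (2 * r) ^ m, by positivity, ?_⟩
  intro n hn xs hxs
  set a := mleRaw φ xs with ha
  have hn' : (0 : ℝ) < n := by positivity
  have hn1 : (1 : ℝ) ≤ n := by exact_mod_cast hn
  have hG := GG_pos hF xs
  have hball : Metric.closedBall a (r / n) ⊆ K' := by
    intro b hb
    refine hen a hxs b ?_
    rw [← dist_eq_norm]
    exact (Metric.mem_closedBall.1 hb).trans (div_le_self hr.le hn1)
  have hMm : MeasurableSet M := (M_open hF).measurableSet
  have hωint := integ_of_one hωi
  have hint : IntegrableOn (fun b => ω b * likelihood p b xs) M := by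
    refine (hωint.mul_const (GG θ ψ φ carrier xs)).mono
      ((hωc.mul (lik_cont hF xs)).aestronglyMeasurable hMm) ?_
    refine (ae_restrict_iff' hMm).2 (Eventually.of_forall fun b hb => ?_)
    have h1 := lik_pos hF xs hb
    have h2 := hωp b hb
    rw [norm_mul, norm_mul, Real.norm_of_nonneg h1.le, Real.norm_of_nonneg hG.le]
    gcongr
    rw [lik_form hF hn xs hb]
    refine mul_le_of_le_one_right hG.le (Real.exp_le_one_iff.2 ?_)
    have := DD_nonneg hF (hKM hxs) hb
    have : 0 ≤ n * DD θ ψ (mleRaw φ xs) b := by positivity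
    linarith
  have hvol : volume.real (Metric.closedBall a (r / n)) = (2 * (r / n)) ^ m := by
    rw [Measure.real, Real.volume_pi_closedBall _ (by positivity), ENNReal.toReal_ofReal (by positivity)]
    simp
  unfold bayesMarginal
  calc GG θ ψ φ carrier xs * (w * Real.exp (-e) * (2 * r) ^ m * ((n : ℝ) ^ m)⁻¹)
      = ∫ b in Metric.closedBall a (r / n), w * (GG θ ψ φ carrier xs * Real.exp (-e)) := by
        rw [setIntegral_const, hvol, smul_eq_mul, ← mul_div_assoc, div_pow, div_eq_mul_inv]
        ring
    _ ≤ ∫ b in Metric.closedBall a (r / n), ω b * likelihood p b xs := by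
        refine setIntegral_mono_on ?_ (hint.mono_set (hball.trans hK'M)) Metric.isClosed_closedBall.measurableSet ?_
        · exact integrableOn_const (by rw [Real.volume_pi_closedBall _ (by positivity)]; exact ENNReal.ofReal_ne_top)
        intro b hb
        have hbK := hball hb
        have h1 := hwle b hbK
        rw [lik_form hF hn xs (hK'M hbK)]
        have h2 : n * DD θ ψ (mleRaw φ xs) b ≤ e := by
          have h3 := DD_upper hF (hKM hxs) (hK'M hbK) (hbd _ (hKK' hxs)).1 (hbd _ hbK).1
          have h4 : ‖b - mleRaw φ xs‖ ≤ r / n := by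
            rw [← dist_eq_norm]; exact hb
          calc n * DD θ ψ (mleRaw φ xs) b ≤ n * (2 * B * m * (r / n)) := by
                gcongr
                exact h3.trans (by gcongr)
            _ = e := by rw [he]; field_simp
        have h5 : 0 ≤ ω b := hw.le.trans h1
        gcongr
    _ ≤ _ := by
        refine setIntegral_mono_set hint ?_ (hball.trans hK'M).eventuallyLE
        refine (ae_restrict_iff' hMm).2 (Eventually.of_forall fun b hb => ?_)
        exact mul_nonneg (hωp b hb).le (lik_pos hF xs hb).le

lemma embed0_cont {m₀ : ℕ} (h : m₀ ≤ m) (fixed : Fin m → ℝ) : Continuous (embed0 h fixed) := by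
  refine continuous_pi fun j => ?_
  unfold embed0
  split_ifs <;> fun_prop

lemma embed0_pre {m₀ : ℕ} (h : m₀ ≤ m) (fixed : Fin m → ℝ) :
    embed0 h fixed ⁻¹' nestedSub m₀ M fixed = embed0 h fixed ⁻¹' M := by
  ext t
  simp only [nestedSub, mem_preimage, mem_ofPred_eq, and_iff_left_iff_imp]
  intro _ j hj
  simp [embed0, not_lt.2 hj]

lemma marg0 (hF : IsMeanValueExpFam ν M p θ φ ψ carrier) {K : Set (Fin m → ℝ)}
    (hK : IsCompact K) (hKM : K ⊆ M) {m₀ : ℕ} (h : m₀ ≤ m) (fixed : Fin m → ℝ)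
    {ω : (Fin m₀ → ℝ) → ℝ}
    (hωc : ContinuousOn ω (embed0 h fixed ⁻¹' nestedSub m₀ M fixed))
    (hωp : ∀ t ∈ embed0 h fixed ⁻¹' nestedSub m₀ M fixed, 0 < ω t)
    (hωi : (∫ t in embed0 h fixed ⁻¹' nestedSub m₀ M fixed, ω t) = 1) :
    ∃ c > 0, ∀ n : ℕ, 0 < n → ∀ xs : Fin n → 𝒳, mleRaw φ xs ∈ K →
      0 < bayesMarginal (fun t => p (embed0 h fixed t))
        (embed0 h fixed ⁻¹' nestedSub m₀ M fixed) ω xs ∧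
      bayesMarginal (fun t => p (embed0 h fixed t))
        (embed0 h fixed ⁻¹' nestedSub m₀ M fixed) ω xs ≤
      GG θ ψ φ carrier xs * Real.exp (-(n * (c * sqDist (mleRaw φ xs) (proj0 m₀ fixed (mleRaw φ xs))))) := by
  obtain ⟨c, hc, hD⟩ := DD_sub hF hK hKM m₀ fixed
  refine ⟨c, hc, ?_⟩
  intro n hn xs hxs
  set T := embed0 h fixed ⁻¹' nestedSub m₀ M fixed with hT
  have hTM : ∀ t ∈ T, embed0 h fixed t ∈ M := fun t ht => ht.1
  have hTm : MeasurableSet T := by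
    rw [hT, embed0_pre]
    exact ((M_open hF).preimage (embed0_cont h fixed)).measurableSet
  have hG := GG_pos hF xs
  set R := GG θ ψ φ carrier xs * Real.exp (-(n * (c * sqDist (mleRaw φ xs) (proj0 m₀ fixed (mleRaw φ xs))))) with hR
  have hR0 : 0 < R := by positivity
  have hle : ∀ t ∈ T, likelihood (fun t => p (embed0 h fixed t)) t xs ≤ R := by
    intro t ht
    change likelihood p (embed0 h fixed t) xs ≤ R
    rw [lik_form hF hn xs (hTM t ht), hR]
    have := hD _ hxs _ ht
    gcongr
  have hpos : ∀ t ∈ T, 0 < likelihood (fun t => p (embed0 h fixed t)) t xs :=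
    fun t ht => lik_pos hF xs (hTM t ht)
  have hωint : IntegrableOn ω T := integ_of_one hωi
  have hint : IntegrableOn (fun t => ω t * likelihood (fun t => p (embed0 h fixed t)) t xs) T := by
    refine (hωint.mul_const R).mono
      ((hωc.mul ((lik_cont hF xs).comp (embed0_cont h fixed).continuousOn hTM)).aestronglyMeasurable hTm) ?_
    refine (ae_restrict_iff' hTm).2 (Eventually.of_forall fun t ht => ?_)
    have h1 := hpos t ht
    have h2 := hωp t ht
    rw [norm_mul, norm_mul, Real.norm_of_nonneg h1.le, Real.norm_of_nonneg hR0.le]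
    gcongr
    exact hle t ht
  unfold bayesMarginal
  constructor
  · rw [setIntegral_pos_iff_support_of_nonneg_ae _ hint]
    · have hTv : 0 < volume T := by
        rw [pos_iff_ne_zero]
        intro h0
        rw [Measure.restrict_eq_zero.2 h0] at hωi
        simp at hωi
      refine hTv.trans_le (measure_mono fun t ht => ⟨?_, ht⟩)
      exact (mul_pos (hωp t ht) (hpos t ht)).ne'
    · refine (ae_restrict_iff' hTm).2 (Eventually.of_forall fun t ht => ?_)
      exact (mul_pos (hωp t ht) (hpos t ht)).le
  · calc _ ≤ ∫ t in T, ω t * R := by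
          refine setIntegral_mono_on hint (hωint.mul_const R) hTm fun t ht => ?_
          have := (hωp t ht).le
          have := hle t ht
          gcongr
      _ = R := by rw [integral_mul_const, hωi, one_mul]

lemma prod_lint [SigmaFinite ν] {f : 𝒳 → ℝ} (hf0 : ∀ x, 0 ≤ f x) (hf : Integrable f ν) (n : ℕ) :
    ∫⁻ xs, ENNReal.ofReal (∏ i, f (xs i)) ∂(Measure.pi fun _ : Fin n => ν) =
      (∫⁻ x, ENNReal.ofReal (f x) ∂ν) ^ n := by
  rw [← ofReal_integral_eq_lintegral_ofReal (Integrable.fintype_prod fun _ => hf)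
    (Eventually.of_forall fun xs => Finset.prod_nonneg fun i _ => hf0 _),
    ← ofReal_integral_eq_lintegral_ofReal hf (Eventually.of_forall hf0),
    ← ENNReal.ofReal_pow (integral_nonneg hf0)]
  rw [integral_fintype_prod_eq_pow]
  simp

lemma iid_mass (hF : IsMeanValueExpFam ν M p θ φ ψ carrier) [SigmaFinite ν] {b : Fin m → ℝ} (hb : b ∈ M) (n : ℕ)
    (S : Set (Fin n → 𝒳)) : iidLaw ν (p b) n S ≤ 1 := by
  refine (measure_mono (subset_univ S)).trans ?_
  unfold iidLaw
  rw [withDensity_apply' , Measure.restrict_univ,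
    prod_lint (fun x => (p_pos hF hb x).le) (p_int hF hb), lint_p hF hb, one_pow]

lemma chern (hF : IsMeanValueExpFam ν M p θ φ ψ carrier) [SigmaFinite ν] {b : Fin m → ℝ} (hb : b ∈ M) 
    {j : Fin m} {t C : ℝ} 
    (hC : ∫⁻ x, ENNReal.ofReal (Real.exp (t * (φ x j - b j)) * p b x) ∂ν ≤ ENNReal.ofReal (Real.exp C))
    (n : ℕ) (u : ℝ) :
    iidLaw ν (p b) n {xs | n * u ≤ ∑ i, t * (φ (xs i) j - b j)} ≤
      ENNReal.ofReal (Real.exp (n * (C - u))) := by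
  set f : 𝒳 → ℝ := fun x => Real.exp (t * (φ x j - b j)) * p b x with hf
  have hf0 : ∀ x, 0 ≤ f x := fun x => (mul_pos (exp_pos _) (p_pos hF hb x)).le
  have hfm : Measurable f := by
    have : Measurable (fun x => φ x j) := (measurable_pi_apply j).comp hF.φ_meas
    exact (((this.sub_const _).const_mul _).exp).mul (hF.p_meas b)
  have hfi : Integrable f ν := by
    refine ⟨hfm.aestronglyMeasurable, ?_⟩
    rw [hasFiniteIntegral_iff_ofReal (Eventually.of_forall hf0)]
    exact hC.trans_lt ENNReal.ofReal_lt_top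
  unfold iidLaw
  rw [withDensity_apply']
  set S := {xs : Fin n → 𝒳 | n * u ≤ ∑ i, t * (φ (xs i) j - b j)} with hS
  have hSm : MeasurableSet S := by
    refine measurableSet_le measurable_const (Finset.measurable_sum _ fun i _ => ?_)
    have : Measurable (fun x => φ x j) := (measurable_pi_apply j).comp hF.φ_meas
    exact ((this.comp (measurable_pi_apply i)).sub_const _).const_mul _
  calc _ ≤ ∫⁻ xs in S, ENNReal.ofReal (Real.exp (-(n * u))) * ENNReal.ofReal (∏ i, f (xs i))
          ∂(Measure.pi fun _ : Fin n => ν) := by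
        refine setLIntegral_mono' hSm fun xs hxs => ?_
        rw [← ENNReal.ofReal_mul (exp_pos _).le]
        apply ENNReal.ofReal_le_ofReal
        simp only [hf]
        rw [Finset.prod_mul_distrib, ← Real.exp_sum, ← mul_assoc, ← Real.exp_add]
        refine le_mul_of_one_le_left (Finset.prod_nonneg fun i _ => (p_pos hF hb _).le) ?_
        rw [Real.one_le_exp_iff]
        have : n * u ≤ ∑ i, t * (φ (xs i) j - b j) := hxs
        linarith
    _ ≤ ∫⁻ xs, ENNReal.ofReal (Real.exp (-(n * u))) * ENNReal.ofReal (∏ i, f (xs i))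
          ∂(Measure.pi fun _ : Fin n => ν) := setLIntegral_le_lintegral _ _
    _ = ENNReal.ofReal (Real.exp (-(n * u))) * (∫⁻ x, ENNReal.ofReal (f x) ∂ν) ^ n := by
        rw [lintegral_const_mul' _ _ ENNReal.ofReal_ne_top, prod_lint hf0 hfi]
    _ ≤ ENNReal.ofReal (Real.exp (-(n * u))) * (ENNReal.ofReal (Real.exp C)) ^ n := by gcongr
    _ = _ := by
        rw [← ENNReal.ofReal_pow (exp_pos _).le, ← ENNReal.ofReal_mul (exp_pos _).le, ← Real.exp_nat_mul,
          ← Real.exp_add]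
        congr 2; ring

lemma tail (hF : IsMeanValueExpFam ν M p θ φ ψ carrier) [SigmaFinite ν] {K : Set (Fin m → ℝ)}
    (hK : IsCompact K) (hKM : K ⊆ M) (hm : 0 < m) {ρ : ℝ} (hρ : 0 < ρ) :
    ∃ η₀ > 0, ∀ η > 0, η ≤ η₀ → ∀ n : ℕ, 0 < n → ∀ b ∈ K, ∀ v : ℝ, v ≤ ρ ^ 2 →
      iidLaw ν (p b) n {xs | ∃ j, v ≤ (mleRaw φ xs j - b j) ^ 2} ≤
        ENNReal.ofReal (2 * m * Real.exp (-(n * (η * v)))) := by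
  obtain ⟨κ, hκ, s₀, hs₀, hmgf⟩ := mgf_bound hF hK hKM
  set s := min (s₀ / ρ) (1 / (2 * κ)) with hsdef
  have hs : 0 < s := by positivity
  have hm1 : (1 : ℝ) ≤ m := by exact_mod_cast hm
  refine ⟨s / 2, by positivity, ?_⟩
  intro η hη hηle n hn b hb v hv
  have hn' : (0 : ℝ) < n := by positivity
  by_cases hv0 : v ≤ 0
  · refine (iid_mass hF (hKM hb) n _).trans ?_
    rw [← ENNReal.ofReal_one]
    apply ENNReal.ofReal_le_ofReal
    have : 1 ≤ Real.exp (-(n * (η * v))) := by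
      rw [Real.one_le_exp_iff]
      have : n * (η * v) ≤ 0 := mul_nonpos_of_nonneg_of_nonpos hn'.le (mul_nonpos_of_nonneg_of_nonpos hη.le hv0)
      linarith
    nlinarith
  push Not at hv0
  set u := √v with hu
  have hu0 : 0 < u := Real.sqrt_pos.2 hv0
  have huv : u ^ 2 = v := Real.sq_sqrt hv0.le
  have huρ : u ≤ ρ := Real.sqrt_le_iff.2 ⟨hρ.le, hv⟩
  set t := s * u with ht
  have ht0 : 0 < t := by positivity
  have hts : t ≤ s₀ := by
    calc t ≤ s₀ / ρ * ρ := by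
          rw [ht]; gcongr
          exact min_le_left _ _
      _ = s₀ := by field_simp
  have hb2 : n * (κ * t ^ 2 - s * v) ≤ -(n * (η * v)) := by
    have h5 : s * κ ≤ 1 / 2 := by
      have : s ≤ 1 / (2 * κ) := min_le_right _ _
      rw [le_div_iff₀ (by positivity)] at this
      linarith
    have h6 : κ * t ^ 2 - s * v = - (s * v * (1 - s * κ)) := by rw [ht, ← huv]; ring
    have h7 : η * v ≤ s * v * (1 - s * κ) := by
      have : 0 < s * v := by positivity
      nlinarith
    rw [h6]
    have := mul_le_mul_of_nonneg_left h7 hn'.le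
    linarith
  have h1 : ∀ j, iidLaw ν (p b) n {xs | n * (s * v) ≤ ∑ i, t * (φ (xs i) j - b j)} ≤
      ENNReal.ofReal (Real.exp (-(n * (η * v)))) := fun j =>
    (chern hF (hKM hb) (hmgf b hb j t (by rwa [abs_of_pos ht0])) n _).trans
      (ENNReal.ofReal_le_ofReal (Real.exp_le_exp.2 hb2))
  have h2 : ∀ j, iidLaw ν (p b) n {xs | n * (s * v) ≤ ∑ i, (-t) * (φ (xs i) j - b j)} ≤
      ENNReal.ofReal (Real.exp (-(n * (η * v)))) := fun j =>
    (chern hF (hKM hb) (hmgf b hb j (-t) (by rwa [abs_neg, abs_of_pos ht0])) n _).trans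
      (ENNReal.ofReal_le_ofReal (Real.exp_le_exp.2 (by rwa [neg_sq])))
  have hsub : {xs : Fin n → 𝒳 | ∃ j, v ≤ (mleRaw φ xs j - b j) ^ 2} ⊆
      ⋃ j : Fin m, ({xs | n * (s * v) ≤ ∑ i, t * (φ (xs i) j - b j)} ∪
        {xs | n * (s * v) ≤ ∑ i, (-t) * (φ (xs i) j - b j)}) := by
    rintro xs ⟨j, hj⟩
    rw [mem_iUnion]
    refine ⟨j, ?_⟩
    have hsum : ∀ q : ℝ, ∑ i, q * (φ (xs i) j - b j) = n * (q * (mleRaw φ xs j - b j)) := by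
      intro q
      rw [← Finset.mul_sum, Finset.sum_sub_distrib]
      simp only [mleRaw, Finset.sum_const, Finset.card_univ, Fintype.card_fin, nsmul_eq_mul]
      field_simp
    have hu2 : u ≤ |mleRaw φ xs j - b j| := by
      rw [← huv] at hj
      exact (sq_le_sq₀ hu0.le (abs_nonneg _)).1 (by rwa [sq_abs])
    have hsv : s * v = t * u := by rw [ht, ← huv]; ring
    rcases le_abs.1 hu2 with h | h
    · left
      change n * (s * v) ≤ _
      rw [hsum, hsv]
      gcongr
    · right
      change n * (s * v) ≤ _
      rw [hsum, hsv, neg_mul, ← mul_neg]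
      gcongr
  refine (measure_mono hsub).trans ((measure_iUnion_fintype_le _ _).trans ?_)
  calc _ ≤ ∑ j : Fin m, (ENNReal.ofReal (Real.exp (-(n * (η * v)))) + ENNReal.ofReal (Real.exp (-(n * (η * v))))) :=
        Finset.sum_le_sum fun j _ => (measure_union_le _ _).trans (add_le_add (h1 j) (h2 j))
    _ = _ := by
        rw [← ENNReal.ofReal_add (exp_pos _).le (exp_pos _).le]
        rw [Finset.sum_const, Finset.card_univ, Fintype.card_fin, ← ENNReal.ofReal_nsmul]
        congr 1
        rw [nsmul_eq_mul]; ring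

lemma sqDist_tri (m₀ : ℕ) (fixed a b : Fin m → ℝ) :
    sqDist a (proj0 m₀ fixed a) ≤ 2 * sqDist b (proj0 m₀ fixed b) + 2 * ∑ j, (b j - a j) ^ 2 := by
  unfold sqDist
  rw [Finset.mul_sum, Finset.mul_sum, ← Finset.sum_add_distrib]
  refine Finset.sum_le_sum fun j _ => ?_
  unfold proj0
  split_ifs
  · nlinarith [sq_nonneg (b j - a j)]
  · nlinarith [sq_nonneg (b j - fixed j + (b j - a j))]


end aux
end SwitchPaper

namespace SwitchPaper

/-- Lemma 4: in the nested setting, for every CINECSI subset `M₁'` of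
`M₁` there are positive constants `c₁, c₂, c₃` and `b₁, b₂, b₃` such that for all `n`, all
`μ₁ ∈ M₁'` and all `A ∈ ℝ`,
`P_{μ₁}(log(p_{B,1}(Xⁿ)/p_{B,0}(Xⁿ)) < A) ≤
  n^{m₁/2}·c₁·e^{c₂A/2}·e^{−(n/2)c₃‖μ₁−μ₀‖₂²} + small_b(n)` with `μ₀ = Π₀(μ₁)`. -/
theorem statement_15 {𝒳 : Type*} [MeasurableSpace 𝒳] {m₀ m₁ : ℕ} (hm : m₀ < m₁)
    (ν : Measure 𝒳) [SigmaFinite ν]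
    (M₁ : Set (Fin m₁ → ℝ)) (p : (Fin m₁ → ℝ) → 𝒳 → ℝ)
    (θ : (Fin m₁ → ℝ) → (Fin m₁ → ℝ)) (φ : 𝒳 → (Fin m₁ → ℝ)) (ψ : (Fin m₁ → ℝ) → ℝ)
    (carrier : 𝒳 → ℝ)
    (hF : IsMeanValueExpFam ν M₁ p θ φ ψ carrier)
    (fixed : Fin m₁ → ℝ)
    (hM₀ : (nestedSub m₀ M₁ fixed).Nonempty)
    (M₁' : Set (Fin m₁ → ℝ)) (hM₁' : CINECSI M₁' M₁)
    -- continuous, strictly positive prior densities and the Bayes marginals: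
    (ω₁ : (Fin m₁ → ℝ) → ℝ) (hω₁c : ContinuousOn ω₁ M₁) (hω₁pos : ∀ μ ∈ M₁, 0 < ω₁ μ)
    (hω₁int : (∫ μ in M₁, ω₁ μ) = 1)
    (ω₀ : (Fin m₀ → ℝ) → ℝ)
    (hω₀c : ContinuousOn ω₀ (embed0 hm.le fixed ⁻¹' nestedSub m₀ M₁ fixed))
    (hω₀pos : ∀ t ∈ embed0 hm.le fixed ⁻¹' nestedSub m₀ M₁ fixed, 0 < ω₀ t)
    (hω₀int : (∫ t in embed0 hm.le fixed ⁻¹' nestedSub m₀ M₁ fixed, ω₀ t) = 1)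
    (pB0 pB1 : (k : ℕ) → (Fin k → 𝒳) → ℝ)
    (hpB1 : ∀ k (xs : Fin k → 𝒳), pB1 k xs = bayesMarginal p M₁ ω₁ xs)
    (hpB0 : ∀ k (xs : Fin k → 𝒳), pB0 k xs =
      bayesMarginal (fun t => p (embed0 hm.le fixed t))
        (embed0 hm.le fixed ⁻¹' nestedSub m₀ M₁ fixed) ω₀ xs) :
    ∃ c₁ > (0:ℝ), ∃ c₂ > (0:ℝ), ∃ c₃ > (0:ℝ), ∃ b₁ > (0:ℝ), ∃ b₂ > (0:ℝ), ∃ b₃ > (0:ℝ),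
      ∀ n : ℕ, ∀ μ₁ ∈ M₁', ∀ A : ℝ,
        (iidLaw ν (p μ₁) n) {xs | Real.log (pB1 n xs / pB0 n xs) < A}
          ≤ ENNReal.ofReal
              ((n : ℝ) ^ ((m₁ : ℝ) / 2) * c₁ * Real.exp (c₂ * A / 2) *
                  Real.exp (-(n : ℝ) / 2 * c₃ * sqDist μ₁ (proj0 m₀ fixed μ₁))
                + smallFn b₁ b₂ b₃ n) := by
  have hm0 : 0 < m₁ := by omega
  have hmR : (0 : ℝ) < m₁ := by exact_mod_cast hm0
  have hm1 : (1 : ℝ) ≤ m₁ := by exact_mod_cast hm0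
  have hKc : IsCompact M₁' := hM₁'.2.2.1
  have hKM : M₁' ⊆ M₁ := hM₁'.2.1.trans interior_subset
  obtain ⟨r, hr, K', hK', hKK', hK'M, hen⟩ := enlarge hKc (M_open hF) hKM
  obtain ⟨c, hc, h1⟩ := marg1_lower hF hK' hK'M hω₁c hω₁pos hω₁int
  obtain ⟨d, hd, h0⟩ := marg0 hF hK' hK'M hm.le fixed hω₀c hω₀pos hω₀int
  obtain ⟨η₀, hη₀, htail⟩ := tail hF hKc hKM hm0 hr
  set η := min η₀ (d / 2) with hη
  have hηp : 0 < η := by positivity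
  have hηd : η / d ≤ m₁ / 2 := by
    have : η ≤ d / 2 := min_le_right _ _
    rw [div_le_iff₀ hd]
    nlinarith
  set C := -Real.log c with hC
  refine ⟨2 * m₁ * Real.exp (η * C / (m₁ * d)), by positivity, 2 * η / (m₁ * d), by positivity,
    η / m₁, by positivity, 1, one_pos, 2 * m₁, by positivity, η * r ^ 2, by positivity, ?_⟩
  intro n μ₁ hμ A
  rcases Nat.eq_zero_or_pos n with hn | hn
  · refine (iid_mass hF (hKM hμ) n _).trans ?_
    rw [← ENNReal.ofReal_one]
    apply ENNReal.ofReal_le_ofReal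
    have : smallFn 1 (2 * m₁) (η * r ^ 2) n = 1 := by simp [smallFn, hn]
    rw [this]
    have : 0 ≤ (n : ℝ) ^ ((m₁ : ℝ) / 2) * (2 * m₁ * Real.exp (η * C / (m₁ * d))) *
      Real.exp (2 * η / (m₁ * d) * A / 2) *
        Real.exp (-(n : ℝ) / 2 * (η / m₁) * sqDist μ₁ (proj0 m₀ fixed μ₁)) := by positivity
    linarith
  have hn' : (0 : ℝ) < n := by exact_mod_cast hn
  have hn1 : (1 : ℝ) ≤ n := by exact_mod_cast hn
  have hsm : smallFn 1 (2 * m₁) (η * r ^ 2) n = 2 * m₁ * Real.exp (-(n * (η * r ^ 2))) := by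
    unfold smallFn
    rw [if_neg (not_lt.2 hn1)]
    congr 2; ring
  set δ := sqDist μ₁ (proj0 m₀ fixed μ₁) with hδ
  set s := δ / 2 - (A + m₁ * Real.log n + C) / (n * d) with hs
  have hsub : {xs : Fin n → 𝒳 | Real.log (pB1 n xs / pB0 n xs) < A} ⊆
      {xs | ∃ j, min (s / m₁) (r ^ 2) ≤ (mleRaw φ xs j - μ₁ j) ^ 2} := by
    intro xs hxs
    change Real.log (pB1 n xs / pB0 n xs) < A at hxs
    change ∃ j, min (s / m₁) (r ^ 2) ≤ (mleRaw φ xs j - μ₁ j) ^ 2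
    by_contra hcon
    push Not at hcon
    have hin : mleRaw φ xs ∈ K' := by
      refine hen μ₁ hμ _ ((pi_norm_le_iff_of_nonneg hr.le).2 fun j => ?_)
      rw [Real.norm_eq_abs, Pi.sub_apply]
      refine abs_le_of_sq_le_sq ?_ hr.le
      exact ((hcon j).trans_le (min_le_right _ _)).le
    obtain ⟨h0p, h0l⟩ := h0 n hn xs hin
    have h1l := h1 n hn xs hin
    rw [← hpB0] at h0p h0l
    rw [← hpB1] at h1l
    set q := sqDist (mleRaw φ xs) (proj0 m₀ fixed (mleRaw φ xs)) with hq
    have hG := GG_pos hF xs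
    have hratio : c * ((n : ℝ) ^ m₁)⁻¹ * Real.exp (n * (d * q)) ≤ pB1 n xs / pB0 n xs := by
      rw [le_div_iff₀ h0p]
      calc c * ((n : ℝ) ^ m₁)⁻¹ * Real.exp (n * (d * q)) * pB0 n xs
          ≤ c * ((n : ℝ) ^ m₁)⁻¹ * Real.exp (n * (d * q)) *
            (GG θ ψ φ carrier xs * Real.exp (-(n * (d * q)))) := by gcongr
        _ = GG θ ψ φ carrier xs * (c * ((n : ℝ) ^ m₁)⁻¹) *
            (Real.exp (n * (d * q)) * Real.exp (-(n * (d * q)))) := by ring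
        _ = GG θ ψ φ carrier xs * (c * ((n : ℝ) ^ m₁)⁻¹) := by
            rw [← Real.exp_add, add_neg_cancel, Real.exp_zero, mul_one]
        _ ≤ _ := h1l
    have hlog := (Real.log_le_log (by positivity) hratio).trans_lt hxs
    rw [Real.log_mul (by positivity) (by positivity), Real.log_mul (by positivity) (by positivity),
      Real.log_inv, Real.log_pow, Real.log_exp] at hlog
    have htri := sqDist_tri m₀ fixed μ₁ (mleRaw φ xs)
    have hsum : ∑ j, (mleRaw φ xs j - μ₁ j) ^ 2 < s := by
      calc _ < ∑ _j : Fin m₁, s / m₁ := by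
            refine Finset.sum_lt_sum_of_nonempty ⟨⟨0, hm0⟩, Finset.mem_univ _⟩ fun j _ => ?_
            exact (hcon j).trans_le (min_le_left _ _)
        _ = s := by
            rw [Finset.sum_const, Finset.card_univ, Fintype.card_fin, nsmul_eq_mul]
            field_simp
    have hq1 : (A + m₁ * Real.log n + C) / (n * d) < q := by
      have : δ < 2 * q + 2 * s := by linarith
      rw [hs] at this
      linarith
    rw [div_lt_iff₀ (by positivity)] at hq1
    rw [hC] at hq1
    nlinarith
  refine (measure_mono hsub).trans ?_
  refine (htail η hηp (min_le_left _ _) n hn μ₁ hμ _ (min_le_right _ _)).trans ?_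
  apply ENNReal.ofReal_le_ofReal
  rw [hsm]
  rcases le_total (s / m₁) (r ^ 2) with hcase | hcase
  · rw [min_eq_left hcase]
    have e1 : Real.exp (-(n * (η * (s / m₁)))) =
        Real.exp (Real.log n * (η / d)) * Real.exp (η * C / (m₁ * d)) *
          Real.exp (2 * η / (m₁ * d) * A / 2) * Real.exp (-(n : ℝ) / 2 * (η / m₁) * δ) := by
      rw [← Real.exp_add, ← Real.exp_add, ← Real.exp_add]
      congr 1
      rw [hs]
      field_simp
      ring
    have e2 : Real.exp (Real.log n * (η / d)) ≤ (n : ℝ) ^ ((m₁ : ℝ) / 2) := by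
      rw [← Real.rpow_def_of_pos hn']
      exact Real.rpow_le_rpow_of_exponent_le hn1 hηd
    rw [e1]
    have e3 : 0 ≤ 2 * m₁ * Real.exp (-(n * (η * r ^ 2))) := by positivity
    calc _ ≤ 2 * m₁ * ((n : ℝ) ^ ((m₁ : ℝ) / 2) * Real.exp (η * C / (m₁ * d)) *
          Real.exp (2 * η / (m₁ * d) * A / 2) * Real.exp (-(n : ℝ) / 2 * (η / m₁) * δ)) := by gcongr
      _ = (n : ℝ) ^ ((m₁ : ℝ) / 2) * (2 * m₁ * Real.exp (η * C / (m₁ * d))) *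
          Real.exp (2 * η / (m₁ * d) * A / 2) * Real.exp (-(n : ℝ) / 2 * (η / m₁) * δ) := by ring
      _ ≤ _ := by linarith
  · rw [min_eq_right hcase]
    have : 0 ≤ (n : ℝ) ^ ((m₁ : ℝ) / 2) * (2 * m₁ * Real.exp (η * C / (m₁ * d))) *
      Real.exp (2 * η / (m₁ * d) * A / 2) *
        Real.exp (-(n : ℝ) / 2 * (η / m₁) * δ) := by positivity
    linarith

end SwitchPaper
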